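/- arXiv:math-ph/0601057 — 6 statements merged into one kernel-verified Lean document; each statement's English description precedes it below -/
import Mathlib

section
/- For every ε ∈ (0,1) and all γ, ξ ∈ ℝ, the ground state energy satisfies μ⁽¹⁾(γ,ξ) ≥ (1−ε)·μ⁽¹⁾(0,ξ) − γ₋²/ε, where γ₋ = max(−γ, 0). -/
open MeasureTheory Set Filter

/-- An admissible function on the half-line `[0,∞)`: `u` is continuous on `[0,∞)`,
locally absolutely continuous with derivative `u'` (expressed by the integral
representation), and `u`, `u'`, `t·u(t)` all belong to `L²((0,∞))`. -/
structure AdmissibleHL (u u' : ℝ → ℂ) : Prop where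
  cont : ContinuousOn u (Ici 0)
  locInt : ∀ t ∈ Ici (0:ℝ), IntervalIntegrable u' volume 0 t
  ac : ∀ t ∈ Ici (0:ℝ), u t = u 0 + ∫ s in (0:ℝ)..t, u' s
  memL2 : IntegrableOn (fun t => ‖u t‖ ^ 2) (Ioi 0)
  memL2' : IntegrableOn (fun t => ‖u' t‖ ^ 2) (Ioi 0)
  memL2t : IntegrableOn (fun t => t ^ 2 * ‖u t‖ ^ 2) (Ioi 0)

/-- The quadratic form `q[γ,ξ](u) = ∫₀^∞ (|u'|² + (t-ξ)²|u|²) dt + γ|u(0)|²`. -/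
noncomputable def qform (γ ξ : ℝ) (u u' : ℝ → ℂ) : ℝ :=
  (∫ t in Ioi (0:ℝ), (‖u' t‖ ^ 2 + (t - ξ) ^ 2 * ‖u t‖ ^ 2)) + γ * ‖u 0‖ ^ 2

/-- The ground state energy `μ⁽¹⁾(γ,ξ)`: the infimum of the Rayleigh quotients of
the quadratic form `q[γ,ξ]` over admissible functions not identically zero. -/
noncomputable def mu1 (γ ξ : ℝ) : ℝ :=
  sInf { r : ℝ | ∃ u u' : ℝ → ℂ, AdmissibleHL u u' ∧ (∃ t ∈ Ici (0:ℝ), u t ≠ 0) ∧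
    r = qform γ ξ u u' / ∫ t in Ioi (0:ℝ), ‖u t‖ ^ 2 }

/-- `Θ(γ) = inf_{ξ ∈ ℝ} μ⁽¹⁾(γ,ξ)`. -/
noncomputable def Theta (γ : ℝ) : ℝ := ⨅ ξ : ℝ, mu1 γ ξ

/-- A ground state of `H[γ,ξ]` with eigenvalue `μ`: a twice continuously differentiable
positive function on `[0,∞)`, `L²`-normalized, with `φ, φ', t²·φ(t) ∈ L²((0,∞))`,
satisfying `-φ'' + (t-ξ)²φ = μ·φ` on `[0,∞)` and the boundary condition `φ'(0) = γ·φ(0)`. -/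
structure IsGroundState (γ ξ μ : ℝ) (φ φ' φ'' : ℝ → ℝ) : Prop where
  deriv1 : ∀ t ∈ Ici (0:ℝ), HasDerivWithinAt φ (φ' t) (Ici 0) t
  deriv2 : ∀ t ∈ Ici (0:ℝ), HasDerivWithinAt φ' (φ'' t) (Ici 0) t
  cont2 : ContinuousOn φ'' (Ici 0)
  pos : ∀ t ∈ Ici (0:ℝ), 0 < φ t
  normalized : (∫ t in Ioi (0:ℝ), (φ t) ^ 2) = 1
  memL2 : IntegrableOn (fun t => (φ t) ^ 2) (Ioi 0)
  memL2' : IntegrableOn (fun t => (φ' t) ^ 2) (Ioi 0)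
  memL2t : IntegrableOn (fun t => (t ^ 2 * φ t) ^ 2) (Ioi 0)
  eqn : ∀ t ∈ Ici (0:ℝ), -φ'' t + (t - ξ) ^ 2 * φ t = μ * φ t
  bc : φ' 0 = γ * φ 0

/-- Fundamental theorem of calculus for the square of an indefinite Lebesgue integral. -/
lemma integral_two_mul_primitive_mul {h : ℝ → ℝ} {T : ℝ} (c : ℝ)
    (hh : IntervalIntegrable h volume 0 T) :
    ∫ t in (0:ℝ)..T, 2 * ((c + ∫ s in (0:ℝ)..t, h s) * h t) =
      (c + ∫ s in (0:ℝ)..T, h s) ^ 2 - c ^ 2 := by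
  have hac : AbsolutelyContinuousOnInterval (fun t => c + ∫ s in (0:ℝ)..t, h s) 0 T := by
    have hc : AbsolutelyContinuousOnInterval (fun _ : ℝ => c) 0 T :=
      ((LipschitzWith.const c).lipschitzOnWith).absolutelyContinuousOnInterval
    exact hc.add (hh.absolutelyContinuousOnInterval_intervalIntegral (by simp))
  have key := hac.integral_deriv_mul_eq_sub hac
  simp only [intervalIntegral.integral_same, add_zero, ← pow_two] at key
  rw [← key]
  apply intervalIntegral.integral_congr_ae
  filter_upwards [hh.ae_hasDerivAt_integral] with t ht ht'
  rw [((ht (uIoc_subset_uIcc ht') 0 (by simp)).const_add c).deriv]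
  ring

namespace AdmissibleHL

variable {u u' : ℝ → ℂ}

lemma norm_sq_sub_norm_sq (hu : AdmissibleHL u u') {T : ℝ} (hT : 0 ≤ T) :
    ‖u T‖ ^ 2 - ‖u 0‖ ^ 2 =
      ∫ t in (0:ℝ)..T, 2 * ((u t).re * (u' t).re + (u t).im * (u' t).im) := by
  have hderiv := hu.locInt T hT
  have hcont : ContinuousOn u (uIcc 0 T) :=
    hu.cont.mono (by rw [uIcc_of_le hT]; exact Icc_subset_Ici_self)
  have hre : IntervalIntegrable (fun t => (u' t).re) volume 0 T :=
    ⟨hderiv.1.re, hderiv.2.re⟩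
  have him : IntervalIntegrable (fun t => (u' t).im) volume 0 T :=
    ⟨hderiv.1.im, hderiv.2.im⟩
  have ure : ∀ t ∈ Ici (0:ℝ), (u 0).re + ∫ s in (0:ℝ)..t, (u' s).re = (u t).re := by
    intro t ht
    rw [hu.ac t ht, Complex.add_re]
    congr 1
    exact Complex.reCLM.intervalIntegral_comp_comm (hu.locInt t ht)
  have uim : ∀ t ∈ Ici (0:ℝ), (u 0).im + ∫ s in (0:ℝ)..t, (u' s).im = (u t).im := by
    intro t ht
    rw [hu.ac t ht, Complex.add_im]
    congr 1
    exact Complex.imCLM.intervalIntegral_comp_comm (hu.locInt t ht)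
  have hsub : ∀ t ∈ uIcc 0 T, t ∈ Ici (0:ℝ) := fun t ht => by
    rw [uIcc_of_le hT] at ht
    exact ht.1
  have h1 := integral_two_mul_primitive_mul (u 0).re hre
  have h2 := integral_two_mul_primitive_mul (u 0).im him
  rw [ure T hT, intervalIntegral.integral_congr (g := fun t => 2 * ((u t).re * (u' t).re))
    (fun t ht => by simp only [ure t (hsub t ht)])] at h1
  rw [uim T hT, intervalIntegral.integral_congr (g := fun t => 2 * ((u t).im * (u' t).im))
    (fun t ht => by simp only [uim t (hsub t ht)])] at h2
  simp only [mul_add]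
  rw [intervalIntegral.integral_add, h1, h2]
  · simp only [Complex.sq_norm, Complex.normSq_apply]
    ring
  · exact (hre.continuousOn_mul (Complex.continuous_re.comp_continuousOn hcont)).const_mul 2
  · exact (him.continuousOn_mul (Complex.continuous_im.comp_continuousOn hcont)).const_mul 2

/-- The trace inequality `a |u(0)|² ≤ ε ‖u'‖² + (a² / ε) ‖u‖²`. -/
lemma mul_norm_sq_zero_le (hu : AdmissibleHL u u') (a : ℝ) {ε : ℝ} (hε : 0 < ε) :
    a * ‖u 0‖ ^ 2 ≤ ε * (∫ t in Ioi (0:ℝ), ‖u' t‖ ^ 2) +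
      a ^ 2 / ε * ∫ t in Ioi (0:ℝ), ‖u t‖ ^ 2 := by
  have hg : IntegrableOn (fun t => ε * ‖u' t‖ ^ 2 + a ^ 2 / ε * ‖u t‖ ^ 2) (Ioi 0) :=
    (hu.memL2'.const_mul ε).add (hu.memL2.const_mul (a ^ 2 / ε))
  have hI : ∫ t in Ioi (0:ℝ), (ε * ‖u' t‖ ^ 2 + a ^ 2 / ε * ‖u t‖ ^ 2) =
      ε * (∫ t in Ioi (0:ℝ), ‖u' t‖ ^ 2) + a ^ 2 / ε * ∫ t in Ioi (0:ℝ), ‖u t‖ ^ 2 := by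
    rw [integral_add (hu.memL2'.const_mul ε) (hu.memL2.const_mul (a ^ 2 / ε)),
      integral_const_mul, integral_const_mul]
  rw [← hI]
  set I := ∫ t in Ioi (0:ℝ), (ε * ‖u' t‖ ^ 2 + a ^ 2 / ε * ‖u t‖ ^ 2) with hIdef
  have hpt : ∀ t, -a * (2 * ((u t).re * (u' t).re + (u t).im * (u' t).im)) ≤
      ε * ‖u' t‖ ^ 2 + a ^ 2 / ε * ‖u t‖ ^ 2 := by
    intro t
    have : ε * ‖u' t‖ ^ 2 + a ^ 2 / ε * ‖u t‖ ^ 2 +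
        a * (2 * ((u t).re * (u' t).re + (u t).im * (u' t).im)) =
        ((ε * (u' t).re + a * (u t).re) ^ 2 + (ε * (u' t).im + a * (u t).im) ^ 2) / ε := by
      simp only [Complex.sq_norm, Complex.normSq_apply]
      field_simp
      ring
    have h0 : 0 ≤ ((ε * (u' t).re + a * (u t).re) ^ 2 +
        (ε * (u' t).im + a * (u t).im) ^ 2) / ε := by positivity
    linarith
  have hT : ∀ T, 0 ≤ T → a * ‖u 0‖ ^ 2 - I ≤ a * ‖u T‖ ^ 2 := by
    intro T hT
    have hgT : IntervalIntegrable (fun t => ε * ‖u' t‖ ^ 2 + a ^ 2 / ε * ‖u t‖ ^ 2)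
        volume 0 T := by
      rw [intervalIntegrable_iff_integrableOn_Ioc_of_le hT]
      exact hg.mono_set Ioc_subset_Ioi_self
    have hcont : ContinuousOn u (uIcc 0 T) :=
      hu.cont.mono (by rw [uIcc_of_le hT]; exact Icc_subset_Ici_self)
    have hderiv := hu.locInt T hT
    have hre : IntervalIntegrable (fun t => (u' t).re) volume 0 T :=
      ⟨hderiv.1.re, hderiv.2.re⟩
    have him : IntervalIntegrable (fun t => (u' t).im) volume 0 T :=
      ⟨hderiv.1.im, hderiv.2.im⟩
    have hf : IntervalIntegrable
        (fun t => -a * (2 * ((u t).re * (u' t).re + (u t).im * (u' t).im))) volume 0 T :=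
      (((hre.continuousOn_mul (Complex.continuous_re.comp_continuousOn hcont)).add
        (him.continuousOn_mul (Complex.continuous_im.comp_continuousOn hcont))).const_mul
          2).const_mul (-a)
    have h1 := intervalIntegral.integral_mono_on hT hf hgT (fun t _ => hpt t)
    rw [intervalIntegral.integral_const_mul, ← hu.norm_sq_sub_norm_sq hT,
      intervalIntegral.integral_of_le hT] at h1
    have h2 : ∫ t in Ioc 0 T, (ε * ‖u' t‖ ^ 2 + a ^ 2 / ε * ‖u t‖ ^ 2) ≤ I :=
      setIntegral_mono_set hg (Eventually.of_forall fun t => by positivity)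
        (Ioc_subset_Ioi_self.eventuallyLE)
    linarith
  by_contra! hlt
  have hconst : IntegrableOn (fun _ : ℝ => a * ‖u 0‖ ^ 2 - I) (Ioi 0) := by
    refine Integrable.mono' (hu.memL2.const_mul a) aestronglyMeasurable_const ?_
    refine (ae_restrict_iff' measurableSet_Ioi).2 (Eventually.of_forall fun t ht => ?_)
    rw [Real.norm_of_nonneg (by linarith)]
    exact hT t (le_of_lt ht)
  rw [integrableOn_const_iff] at hconst
  simp at hconst
  linarith

lemma integrableOn_potential (hu : AdmissibleHL u u') (ξ : ℝ) :
    IntegrableOn (fun t => (t - ξ) ^ 2 * ‖u t‖ ^ 2) (Ioi 0) := by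
  refine Integrable.mono' ((hu.memL2t.const_mul 2).add (hu.memL2.const_mul (2 * ξ ^ 2)))
    ?_ (Eventually.of_forall fun t => ?_)
  · exact (by fun_prop : Continuous fun t : ℝ => (t - ξ) ^ 2).aestronglyMeasurable.mul
      hu.memL2.aestronglyMeasurable
  · rw [Real.norm_of_nonneg (by positivity), Pi.add_apply]
    nlinarith [mul_nonneg (sq_nonneg (t + ξ)) (sq_nonneg ‖u t‖)]

lemma qform_lower_bound (hu : AdmissibleHL u u') {ε : ℝ} (hε : 0 < ε) (γ ξ : ℝ) :
    (1 - ε) * qform 0 ξ u u' - (max (-γ) 0) ^ 2 / ε * ∫ t in Ioi (0:ℝ), ‖u t‖ ^ 2 ≤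
      qform γ ξ u u' := by
  have htrace := hu.mul_norm_sq_zero_le (max (-γ) 0) hε
  have hV : 0 ≤ ∫ t in Ioi (0:ℝ), (t - ξ) ^ 2 * ‖u t‖ ^ 2 :=
    integral_nonneg fun t => by positivity
  have hγ : -γ * ‖u 0‖ ^ 2 ≤ max (-γ) 0 * ‖u 0‖ ^ 2 :=
    mul_le_mul_of_nonneg_right (le_max_left _ _) (sq_nonneg _)
  unfold qform
  rw [integral_add hu.memL2' (hu.integrableOn_potential ξ)]
  nlinarith [mul_nonneg hε.le hV]

end AdmissibleHL

lemma mu1_zero_le {u u' : ℝ → ℂ} (ξ : ℝ) (hu : AdmissibleHL u u')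
    (hne : ∃ t ∈ Ici (0:ℝ), u t ≠ 0) :
    mu1 0 ξ ≤ qform 0 ξ u u' / ∫ t in Ioi (0:ℝ), ‖u t‖ ^ 2 := by
  refine csInf_le ⟨0, ?_⟩ ⟨u, u', hu, hne, rfl⟩
  rintro _ ⟨v, v', -, -, rfl⟩
  refine div_nonneg ?_ (integral_nonneg fun t => by positivity)
  rw [qform, zero_mul, add_zero]
  exact integral_nonneg fun t => by positivity

/-- For every `ε ∈ (0,1)` and all `γ, ξ ∈ ℝ`,
`μ⁽¹⁾(γ,ξ) ≥ (1−ε)·μ⁽¹⁾(0,ξ) − γ₋²/ε` where `γ₋ = max(−γ,0)`. -/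
theorem mu1_lower_bound :
    ∀ ε ∈ Ioo (0:ℝ) 1, ∀ γ ξ : ℝ,
      mu1 γ ξ ≥ (1 - ε) * mu1 0 ξ - (max (-γ) 0) ^ 2 / ε := by
  intro ε hε γ ξ
  have hεpos : 0 < ε := hε.1
  have hγ : 0 ≤ (max (-γ) 0) ^ 2 / ε := by positivity
  by_cases hex : ∃ u u' : ℝ → ℂ, AdmissibleHL u u' ∧ ∃ t ∈ Ici (0:ℝ), u t ≠ 0
  · obtain ⟨u₀, u₀', hu₀, hne₀⟩ := hex
    refine le_csInf ⟨_, u₀, u₀', hu₀, hne₀, rfl⟩ ?_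
    rintro _ ⟨u, u', hu, hne, rfl⟩
    have hmu := mul_le_mul_of_nonneg_left (mu1_zero_le ξ hu hne) (sub_nonneg.2 hε.2.le)
    have hq := hu.qform_lower_bound hεpos γ ξ
    rcases (integral_nonneg fun t => by positivity :
      0 ≤ ∫ t in Ioi (0:ℝ), ‖u t‖ ^ 2).eq_or_lt with hN | hN
    · rw [← hN, div_zero, mul_zero] at hmu
      rw [← hN, div_zero]
      linarith
    · rw [le_div_iff₀ hN]
      rw [← mul_div_assoc, le_div_iff₀ hN] at hmu
      linarith
  · have hzero : ∀ γ : ℝ, mu1 γ ξ = 0 := by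
      intro γ
      refine (congrArg sInf (eq_empty_of_forall_notMem ?_)).trans Real.sInf_empty
      rintro _ ⟨u, u', hu, hne, -⟩
      exact hex ⟨u, u', hu, hne⟩
    rw [hzero, hzero]
    linarith
end

section
/- For each fixed γ ∈ ℝ, μ⁽¹⁾(γ,ξ) tends to 1 as ξ tends to +∞. -/
open MeasureTheory Set Filter

/-- Integration by parts for a weight `f` against the square of an indefinite integral. -/
theorem intervalIntegral_weight_mul_sq {f f' p p' : ℝ → ℝ} {T : ℝ} (hT : 0 ≤ T)
    (hf : ∀ t, HasDerivAt f (f' t) t) (hf' : Continuous f')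
    (hp' : IntervalIntegrable p' volume 0 T)
    (hp : ∀ t ∈ Icc 0 T, p t = p 0 + ∫ s in (0:ℝ)..t, p' s) :
    ∫ t in (0:ℝ)..T, (f' t * p t ^ 2 + f t * (2 * (p t * p' t))) =
      f T * p T ^ 2 - f 0 * p 0 ^ 2 := by
  set P : ℝ → ℝ := fun t => p 0 + ∫ s in (0:ℝ)..t, p' s with hP
  have hac : AbsolutelyContinuousOnInterval P 0 T := by
    have hconst : AbsolutelyContinuousOnInterval (fun _ : ℝ => p 0) 0 T :=
      contDiffOn_const.absolutelyContinuousOnInterval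
    exact hconst.add (hp'.absolutelyContinuousOnInterval_intervalIntegral (by simp))
  have hfd : ContDiff ℝ 1 f := by
    rw [contDiff_one_iff_deriv]
    refine ⟨fun t => (hf t).differentiableAt, ?_⟩
    have : deriv f = f' := funext fun t => (hf t).deriv
    rwa [this]
  have hfac : AbsolutelyContinuousOnInterval f 0 T :=
    hfd.contDiffOn.absolutelyContinuousOnInterval
  have hFTC := (hfac.fun_mul (hac.fun_mul hac)).integral_deriv_eq_sub
  rw [hp T (right_mem_Icc.2 hT), sq, sq]
  have h0 : P 0 = p 0 := by simp [hP]
  rw [show p 0 + ∫ s in (0:ℝ)..T, p' s = P T from rfl]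
  rw [h0] at hFTC
  rw [← hFTC]
  apply intervalIntegral.integral_congr_ae
  filter_upwards [hp'.ae_hasDerivAt_integral] with t ht htm
  have htm' : t ∈ uIcc 0 T := uIoc_subset_uIcc htm
  have hd : HasDerivAt P (p' t) t := (ht htm' 0 (by simp)).const_add (p 0)
  have hPt : p t = P t := hp t (by rwa [uIcc_of_le hT] at htm')
  rw [((hf t).fun_mul (hd.fun_mul hd)).deriv, hPt]
  ring

namespace AdmissibleHL

variable {u u' : ℝ → ℂ}

theorem intervalIntegral_weight (h : AdmissibleHL u u') {f f' : ℝ → ℝ}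
    (hf : ∀ t, HasDerivAt f (f' t) t) (hf' : Continuous f') {T : ℝ} (hT : 0 ≤ T) :
    ∫ t in (0:ℝ)..T, (f' t * ‖u t‖ ^ 2 + f t * (2 * inner ℝ (u t) (u' t))) =
      f T * ‖u T‖ ^ 2 - f 0 * ‖u 0‖ ^ 2 := by
  have hint := h.locInt T hT
  have hre : IntervalIntegrable (fun t => (u' t).re) volume 0 T :=
    ⟨hint.1.re, hint.2.re⟩
  have him : IntervalIntegrable (fun t => (u' t).im) volume 0 T :=
    ⟨hint.1.im, hint.2.im⟩
  have hsub : ∀ t ∈ Icc 0 T, IntervalIntegrable u' volume 0 t := fun t ht => h.locInt t ht.1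
  have hpre : ∀ t ∈ Icc 0 T, (u t).re = (u 0).re + ∫ s in (0:ℝ)..t, (u' s).re := by
    intro t ht
    have := Complex.reCLM.intervalIntegral_comp_comm (hsub t ht)
    simp only [Complex.reCLM_apply] at this
    rw [this, h.ac t ht.1]
    simp
  have hpim : ∀ t ∈ Icc 0 T, (u t).im = (u 0).im + ∫ s in (0:ℝ)..t, (u' s).im := by
    intro t ht
    have := Complex.imCLM.intervalIntegral_comp_comm (hsub t ht)
    simp only [Complex.imCLM_apply] at this
    rw [this, h.ac t ht.1]
    simp
  have key1 := intervalIntegral_weight_mul_sq hT hf hf' hre hpre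
  have key2 := intervalIntegral_weight_mul_sq hT hf hf' him hpim
  have hcf : Continuous f := continuous_iff_continuousAt.2 fun t => (hf t).continuousAt
  have hcu : ContinuousOn u (uIcc 0 T) :=
    h.cont.mono (by rw [uIcc_of_le hT]; exact Icc_subset_Ici_self)
  have hcre : ContinuousOn (fun t => (u t).re) (uIcc 0 T) :=
    Complex.continuous_re.comp_continuousOn hcu
  have hcim : ContinuousOn (fun t => (u t).im) (uIcc 0 T) :=
    Complex.continuous_im.comp_continuousOn hcu
  have hnorm : ∀ z : ℂ, ‖z‖ ^ 2 = z.re ^ 2 + z.im ^ 2 := fun z => by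
    rw [Complex.sq_norm, Complex.normSq_apply]; ring
  have i1 : IntervalIntegrable (fun t => f' t * (u t).re ^ 2 +
      f t * (2 * ((u t).re * (u' t).re))) volume 0 T :=
    (hf'.continuousOn.mul (hcre.pow 2)).intervalIntegrable.add
      (((hre.continuousOn_mul hcre).const_mul 2).continuousOn_mul hcf.continuousOn)
  have i2 : IntervalIntegrable (fun t => f' t * (u t).im ^ 2 +
      f t * (2 * ((u t).im * (u' t).im))) volume 0 T :=
    (hf'.continuousOn.mul (hcim.pow 2)).intervalIntegrable.add
      (((him.continuousOn_mul hcim).const_mul 2).continuousOn_mul hcf.continuousOn)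
  rw [hnorm, hnorm]
  calc _ = ∫ t in (0:ℝ)..T, ((f' t * (u t).re ^ 2 + f t * (2 * ((u t).re * (u' t).re))) +
        (f' t * (u t).im ^ 2 + f t * (2 * ((u t).im * (u' t).im)))) := by
        congr 1 with t
        rw [hnorm, Complex.inner, Complex.mul_re, Complex.conj_re, Complex.conj_im]
        ring
    _ = _ := by
        rw [intervalIntegral.integral_add i1 i2, key1, key2]
        ring

theorem aestronglyMeasurable (h : AdmissibleHL u u') :
    AEStronglyMeasurable u (volume.restrict (Ioi 0)) :=
  (h.cont.mono Ioi_subset_Ici_self).aestronglyMeasurable measurableSet_Ioi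

theorem aestronglyMeasurable_deriv (h : AdmissibleHL u u') :
    AEStronglyMeasurable u' (volume.restrict (Ioi 0)) := by
  have hU : Ioi (0:ℝ) = ⋃ n : ℕ, Ioc (0:ℝ) n := by
    ext t
    simp only [mem_Ioi, mem_iUnion, mem_Ioc]
    exact ⟨fun ht => (exists_nat_ge t).imp fun n hn => ⟨ht, hn⟩, fun ⟨_, hn⟩ => hn.1⟩
  rw [hU, aestronglyMeasurable_iUnion_iff]
  exact fun n => (h.locInt n (mem_Ici.2 n.cast_nonneg)).1.aestronglyMeasurable

theorem integrableOn_weight (h : AdmissibleHL u u') {w : ℝ → ℝ} (hw : Continuous w) {C : ℝ}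
    (hC : ∀ t, 0 < t → |w t| ≤ C * (1 + t ^ 2)) :
    IntegrableOn (fun t => w t * ‖u t‖ ^ 2) (Ioi 0) := by
  refine Integrable.mono' ((h.memL2.add h.memL2t).const_mul C)
    (hw.aestronglyMeasurable.mul (h.aestronglyMeasurable.norm.pow 2)) ?_
  filter_upwards [ae_restrict_mem measurableSet_Ioi] with t ht
  rw [Real.norm_eq_abs, abs_mul, abs_of_nonneg (sq_nonneg ‖u t‖)]
  refine (mul_le_mul_of_nonneg_right (hC t ht) (sq_nonneg ‖u t‖)).trans_eq ?_
  simp only [Pi.add_apply]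
  ring

theorem integral_weight (h : AdmissibleHL u u') {f f' : ℝ → ℝ}
    (hf : ∀ t, HasDerivAt f (f' t) t) (hf' : Continuous f') {C : ℝ}
    (hC : ∀ t, 0 < t → |f t| ≤ C * (1 + t)) (hC' : ∀ t, 0 < t → |f' t| ≤ C) :
    IntegrableOn (fun t => f' t * ‖u t‖ ^ 2 + f t * (2 * inner ℝ (u t) (u' t))) (Ioi 0) ∧
    ∫ t in Ioi (0:ℝ), (f' t * ‖u t‖ ^ 2 + f t * (2 * inner ℝ (u t) (u' t))) =
      - (f 0 * ‖u 0‖ ^ 2) := by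
  have hcf : Continuous f := continuous_iff_continuousAt.2 fun t => (hf t).continuousAt
  have hC0 : 0 ≤ C := (abs_nonneg _).trans (hC' 1 one_pos)
  have i1 : IntegrableOn (fun t => f' t * ‖u t‖ ^ 2) (Ioi 0) :=
    h.integrableOn_weight hf' (C := C) fun t ht => (hC' t ht).trans (by nlinarith [sq_nonneg t])
  have i2 : IntegrableOn (fun t => f t ^ 2 * ‖u t‖ ^ 2) (Ioi 0) := by
    refine h.integrableOn_weight (hcf.pow 2) (C := 2 * C ^ 2) fun t ht => ?_
    rw [abs_pow]
    calc |f t| ^ 2 ≤ (C * (1 + t)) ^ 2 := by gcongr; exact hC t ht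
      _ ≤ _ := by nlinarith [mul_nonneg (sq_nonneg C) (sq_nonneg (1 - t))]
  have i3 : IntegrableOn (fun t => f t * ‖u t‖ ^ 2) (Ioi 0) :=
    h.integrableOn_weight hcf (C := 2 * C) fun t ht => (hC t ht).trans (by
      nlinarith [mul_nonneg hC0 (sq_nonneg (1 - t)), mul_nonneg hC0 (sq_nonneg t)])
  have i4 : IntegrableOn (fun t => f t * (2 * inner ℝ (u t) (u' t))) (Ioi 0) := by
    refine Integrable.mono' (i2.add h.memL2') (hcf.aestronglyMeasurable.mul
      ((h.aestronglyMeasurable.inner h.aestronglyMeasurable_deriv).const_mul 2)) ?_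
    refine Eventually.of_forall fun t => ?_
    have hin := abs_real_inner_le_norm (u t) (u' t)
    simp only [Pi.add_apply, Real.norm_eq_abs, abs_mul, abs_two]
    rw [← sq_abs (f t)]
    nlinarith [sq_nonneg (|f t| * ‖u t‖ - ‖u' t‖), mul_le_mul_of_nonneg_left hin (abs_nonneg (f t))]
  have hI := i1.add i4
  refine ⟨hI, ?_⟩
  have hlim := intervalIntegral_tendsto_integral_Ioi 0 hI tendsto_id
  set I := ∫ t in Ioi (0:ℝ), (f' t * ‖u t‖ ^ 2 + f t * (2 * inner ℝ (u t) (u' t)))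
  have hlim2 : Tendsto (fun T => f T * ‖u T‖ ^ 2) atTop (nhds (I + f 0 * ‖u 0‖ ^ 2)) := by
    refine (hlim.add_const (f 0 * ‖u 0‖ ^ 2)).congr' ?_
    filter_upwards [eventually_ge_atTop 0] with T hT
    have := h.intervalIntegral_weight hf hf' hT
    simp only [id, Pi.add_apply]
    rw [this]
    ring
  have hzero : I + f 0 * ‖u 0‖ ^ 2 = 0 := by
    refine IntegrableAtFilter.eq_zero_of_tendsto (μ := volume)
      ⟨Ioi 0, Ioi_mem_atTop _, i3⟩ (fun s hs => ?_) hlim2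
    obtain ⟨b, hb⟩ := mem_atTop_sets.1 hs
    rw [← top_le_iff, ← Real.volume_Ici (a := b)]
    exact measure_mono hb
  linarith

theorem integrableOn_energy (h : AdmissibleHL u u') (ξ : ℝ) :
    IntegrableOn (fun t => ‖u' t‖ ^ 2 + (t - ξ) ^ 2 * ‖u t‖ ^ 2) (Ioi 0) := by
  refine h.memL2'.add (h.integrableOn_weight (w := fun t => (t - ξ) ^ 2) (by fun_prop)
    (C := 2 * (1 + ξ ^ 2)) fun t _ => ?_)
  rw [abs_of_nonneg (sq_nonneg _)]
  nlinarith [sq_nonneg (t + ξ), sq_nonneg (ξ * t)]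

/-- A Riccati subsolution `f` with `f 0 = -γ` bounds the form from below. -/
theorem le_qform_of_riccati (h : AdmissibleHL u u') {γ ξ c C : ℝ} {f f' : ℝ → ℝ}
    (hf : ∀ t, HasDerivAt f (f' t) t) (hf' : Continuous f')
    (hC : ∀ t, 0 < t → |f t| ≤ C * (1 + t)) (hC' : ∀ t, 0 < t → |f' t| ≤ C)
    (hf0 : f 0 = -γ) (hc : ∀ t, 0 < t → c ≤ f' t - f t ^ 2 + (t - ξ) ^ 2) :
    c * (∫ t in Ioi (0:ℝ), ‖u t‖ ^ 2) ≤ qform γ ξ u u' := by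
  obtain ⟨hI, hIeq⟩ := h.integral_weight hf hf' hC hC'
  have hmono : ∫ t in Ioi (0:ℝ), (c * ‖u t‖ ^ 2 -
        (f' t * ‖u t‖ ^ 2 + f t * (2 * inner ℝ (u t) (u' t)))) ≤
      ∫ t in Ioi (0:ℝ), (‖u' t‖ ^ 2 + (t - ξ) ^ 2 * ‖u t‖ ^ 2) := by
    refine setIntegral_mono_on ((h.memL2.const_mul c).sub hI) (h.integrableOn_energy ξ)
      measurableSet_Ioi fun t ht => ?_
    have hsq : 0 ≤ ‖u' t + f t • u t‖ ^ 2 := sq_nonneg _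
    rw [norm_add_sq_real, real_inner_smul_right, norm_smul, mul_pow, Real.norm_eq_abs, sq_abs,
      real_inner_comm] at hsq
    nlinarith [mul_le_mul_of_nonneg_right (hc t ht) (sq_nonneg ‖u t‖)]
  rw [integral_sub (h.memL2.const_mul c) hI, hIeq, integral_const_mul, hf0] at hmono
  rw [qform]
  linarith

theorem integral_norm_sq_pos (h : AdmissibleHL u u') (hne : ∃ t ∈ Ici (0:ℝ), u t ≠ 0) :
    0 < ∫ t in Ioi (0:ℝ), ‖u t‖ ^ 2 := by
  refine (setIntegral_nonneg measurableSet_Ioi fun t _ => sq_nonneg ‖u t‖).lt_of_ne' fun h0 => ?_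
  rw [setIntegral_eq_zero_iff_of_nonneg_ae (Eventually.of_forall fun t => sq_nonneg ‖u t‖)
    h.memL2] at h0
  obtain ⟨t, ht, hut⟩ := hne
  have hae : u =ᵐ[volume.restrict (Ici 0)] fun _ => 0 := by
    rw [← restrict_Ioi_eq_restrict_Ici]
    filter_upwards [h0] with s hs
    simpa using hs
  exact hut (Measure.eqOn_of_ae_eq hae h.cont continuousOn_const (by simp) ht)

end AdmissibleHL

theorem eventually_le_qform (γ : ℝ) {ε : ℝ} (hε : 0 < ε) :
    ∀ᶠ ξ : ℝ in atTop, ∀ u u' : ℝ → ℂ, AdmissibleHL u u' →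
      (1 - ε) * (∫ t in Ioi (0:ℝ), ‖u t‖ ^ 2) ≤ qform γ ξ u u' := by
  have hlim : Tendsto (fun t : ℝ => (2 * t + 1 + 2 * |γ|) * (2 * t) * Real.exp (-t)) atTop
      (nhds 0) := by
    have h2 := (Real.tendsto_pow_mul_exp_neg_atTop_nhds_zero 2).const_mul 4
    have h1 := (Real.tendsto_pow_mul_exp_neg_atTop_nhds_zero 1).const_mul (2 * (1 + 2 * |γ|))
    have h12 := h2.add h1
    simp only [mul_zero, add_zero] at h12
    exact h12.congr fun t => by ring
  obtain ⟨R, hR⟩ := eventually_atTop.1 (hlim.eventually (gt_mem_nhds hε))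
  filter_upwards [eventually_ge_atTop (2 * R + 1 + |γ|), eventually_ge_atTop (1 + |γ|)]
    with ξ hξR hξ u u' h
  have hγ1 := le_abs_self γ
  have hγ2 := neg_abs_le γ
  have hA : 0 ≤ ξ - γ := by linarith
  refine h.le_qform_of_riccati (C := 1 + |ξ| + (ξ - γ))
    (f := fun t => t - ξ + (ξ - γ) * Real.exp (-t))
    (f' := fun t => 1 - (ξ - γ) * Real.exp (-t)) (fun t => ?_) (by fun_prop) (fun t ht => ?_)
    (fun t ht => ?_) (by simp; ring) fun t ht => ?_
  · have := ((hasDerivAt_id t).sub_const ξ).add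
      (((hasDerivAt_neg t).exp).const_mul (ξ - γ))
    convert! this using 1
    ring
  · have he : Real.exp (-t) ≤ 1 := Real.exp_le_one_iff.2 (by linarith)
    have he0 := Real.exp_pos (-t)
    have hx1 := le_abs_self ξ
    have hx2 := neg_abs_le ξ
    rw [abs_le]
    constructor <;>
    nlinarith [mul_nonneg hA he0.le, mul_nonneg hA (sub_nonneg.2 he), mul_nonneg hA ht.le,
      mul_nonneg (abs_nonneg ξ) ht.le]
  · have he : Real.exp (-t) ≤ 1 := Real.exp_le_one_iff.2 (by linarith)
    have he0 := Real.exp_pos (-t)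
    have hx := abs_nonneg ξ
    rw [abs_le]
    constructor <;>
    nlinarith [mul_nonneg hA he0.le, mul_nonneg hA (sub_nonneg.2 he)]
  · have he : Real.exp (-t) ≤ 1 := Real.exp_le_one_iff.2 (by linarith)
    have he0 := Real.exp_pos (-t)
    set e := Real.exp (-t)
    set g := (ξ - γ) * e with hg
    have hg0 : 0 ≤ g := mul_nonneg hA he0.le
    have hgA : g ≤ ξ - γ := mul_le_of_le_one_right hA he
    suffices -ε ≤ g * (2 * ξ - 2 * t - 1 - g) by
      calc 1 - ε ≤ 1 + g * (2 * ξ - 2 * t - 1 - g) := by linarith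
        _ = _ := by ring
    rcases le_or_gt (2 * t) (ξ + γ - 1) with hts | hts
    · have : 0 ≤ g * (2 * ξ - 2 * t - 1 - g) := mul_nonneg hg0 (by linarith)
      linarith
    · have hRt := hR t (by linarith)
      have h1 : g ≤ (2 * t + 1 + 2 * |γ|) * e := mul_le_mul_of_nonneg_right (by linarith) he0.le
      have h2 : g * (-(2 * t)) ≤ g * (2 * ξ - 2 * t - 1 - g) :=
        mul_le_mul_of_nonneg_left (by linarith) hg0
      have h3 := mul_le_mul_of_nonneg_right h1 (by linarith : 0 ≤ 2 * t)
      linarith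

/-- The shifted Gaussian, the trial function for the upper bound. -/
noncomputable def gaussianTrial (ξ t : ℝ) : ℝ := Real.exp (-(t - ξ) ^ 2 / 2)

theorem gaussianTrial_sq (ξ t : ℝ) : gaussianTrial ξ t ^ 2 = Real.exp (-1 * (t - ξ) ^ 2) := by
  rw [gaussianTrial, ← Real.exp_nat_mul]
  congr 1
  push_cast
  ring

theorem hasDerivAt_gaussianTrial (ξ t : ℝ) :
    HasDerivAt (gaussianTrial ξ) (-(t - ξ) * gaussianTrial ξ t) t := by
  have h := ((((hasDerivAt_id t).sub_const ξ).pow 2).neg.div_const 2).exp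
  convert! h using 1
  simp [gaussianTrial]
  ring

theorem continuous_gaussianTrial (ξ : ℝ) : Continuous (gaussianTrial ξ) := by
  unfold gaussianTrial
  fun_prop

theorem admissibleHL_gaussianTrial (ξ : ℝ) :
    AdmissibleHL (fun t => (gaussianTrial ξ t : ℂ))
      (fun t => ((-(t - ξ) * gaussianTrial ξ t : ℝ) : ℂ)) := by
  have hc := continuous_gaussianTrial ξ
  have hc' : Continuous fun t => ((-(t - ξ) * gaussianTrial ξ t : ℝ) : ℂ) := by fun_prop
  have i0 : Integrable fun t => gaussianTrial ξ t ^ 2 := by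
    simp_rw [gaussianTrial_sq]
    exact (integrable_exp_neg_mul_sq one_pos).comp_sub_right ξ
  have i1 : Integrable fun t => (t - ξ) * gaussianTrial ξ t ^ 2 := by
    simp_rw [gaussianTrial_sq]
    exact (integrable_mul_exp_neg_mul_sq one_pos).comp_sub_right ξ
  have i2 : Integrable fun t => (t - ξ) ^ 2 * gaussianTrial ξ t ^ 2 := by
    simp_rw [gaussianTrial_sq]
    have h := integrable_rpow_mul_exp_neg_mul_sq one_pos (show (-1:ℝ) < 2 by norm_num)
    simp only [Real.rpow_two] at h
    exact h.comp_sub_right ξ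
  refine ⟨by fun_prop, fun t _ => hc'.intervalIntegrable _ _, fun t _ => ?_, ?_, ?_, ?_⟩
  · rw [intervalIntegral.integral_eq_sub_of_hasDerivAt
      (fun s _ => (hasDerivAt_gaussianTrial ξ s).ofReal_comp) (hc'.intervalIntegrable _ _)]
    ring
  · simpa using i0.integrableOn
  · refine i2.integrableOn.congr_fun (fun t _ => ?_) measurableSet_Ioi
    simp only [Complex.norm_real, Real.norm_eq_abs, sq_abs]
    ring
  · refine ((i2.add (i1.const_mul (2 * ξ))).add (i0.const_mul (ξ ^ 2))).integrableOn.congr_fun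
      (fun t _ => ?_) measurableSet_Ioi
    simp only [Complex.norm_real, Real.norm_eq_abs, sq_abs, Pi.add_apply]
    ring

/-- The form evaluated at a function satisfying the Gaussian equation `u' = -(t-ξ)u`. -/
theorem AdmissibleHL.qform_eq_of_deriv_eq {u u' : ℝ → ℂ} (h : AdmissibleHL u u') (γ ξ : ℝ)
    (hu : ∀ t, u' t = (-(t - ξ)) • u t) :
    qform γ ξ u u' = (∫ t in Ioi (0:ℝ), ‖u t‖ ^ 2) + (γ - ξ) * ‖u 0‖ ^ 2 := by
  obtain ⟨hI, hIeq⟩ := h.integral_weight (f := fun t => t - ξ) (f' := fun _ => 1) (C := 1 + |ξ|)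
    (fun t => (hasDerivAt_id t).sub_const ξ) continuous_const
    (fun t ht => by
      have h1 := abs_sub t ξ
      rw [abs_of_pos ht] at h1
      nlinarith [mul_nonneg (abs_nonneg ξ) ht.le])
    (fun t _ => by simp)
  have hsplit : ∫ t in Ioi (0:ℝ), (‖u' t‖ ^ 2 + (t - ξ) ^ 2 * ‖u t‖ ^ 2) =
      ∫ t in Ioi (0:ℝ), (‖u t‖ ^ 2 -
        (1 * ‖u t‖ ^ 2 + (t - ξ) * (2 * inner ℝ (u t) (u' t)))) := by
    congr 1 with t
    rw [hu, norm_smul, real_inner_smul_right, real_inner_self_eq_norm_sq, mul_pow,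
      Real.norm_eq_abs, sq_abs]
    ring
  rw [qform, hsplit, integral_sub h.memL2 hI, hIeq]
  ring

/-- For each fixed `γ`, `μ⁽¹⁾(γ,ξ) → 1` as `ξ → +∞`. -/
theorem mu1_tendsto_one (γ : ℝ) :
    Tendsto (fun ξ : ℝ => mu1 γ ξ) atTop (nhds 1) := by
  rw [Metric.tendsto_nhds]
  intro ε hε
  filter_upwards [eventually_le_qform γ (half_pos hε), eventually_ge_atTop γ] with ξ hlow hξ
  set S : Set ℝ := { r : ℝ | ∃ u u' : ℝ → ℂ, AdmissibleHL u u' ∧ (∃ t ∈ Ici (0:ℝ), u t ≠ 0) ∧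
    r = qform γ ξ u u' / ∫ t in Ioi (0:ℝ), ‖u t‖ ^ 2 }
  have hlb : ∀ r ∈ S, 1 - ε / 2 ≤ r := by
    rintro r ⟨u, u', h, hne, rfl⟩
    exact (le_div_iff₀ (h.integral_norm_sq_pos hne)).2 (hlow u u' h)
  have h := admissibleHL_gaussianTrial ξ
  have hne : ∃ t ∈ Ici (0:ℝ), (gaussianTrial ξ t : ℂ) ≠ 0 :=
    ⟨0, self_mem_Ici, Complex.ofReal_ne_zero.2 (Real.exp_pos _).ne'⟩
  have hmem : qform γ ξ _ _ / _ ∈ S := ⟨_, _, h, hne, rfl⟩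
  have hup : mu1 γ ξ ≤ 1 := by
    refine (csInf_le ⟨_, hlb⟩ hmem).trans ?_
    rw [div_le_one (h.integral_norm_sq_pos hne),
      h.qform_eq_of_deriv_eq γ ξ fun t => by simp [Complex.real_smul]]
    have := mul_nonneg (sub_nonneg.2 hξ) (sq_nonneg ‖(gaussianTrial ξ 0 : ℂ)‖)
    linarith
  have hge : 1 - ε / 2 ≤ mu1 γ ξ := le_csInf ⟨_, hmem⟩ hlb
  rw [Real.dist_eq, abs_lt]
  constructor <;> linarith
end

section
/- Given ε ∈ (0,1) and γ ∈ ℝ, there exists a constant C > 0 such that for all ξ ∈ [C, +∞) and every ground state φ of H[γ,ξ], one has |φ(0)|² ≤ C·exp(−εξ/2). -/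
open MeasureTheory Set Filter

namespace IsGroundState

variable {γ ξ μ : ℝ} {φ φ' φ'' : ℝ → ℝ}

theorem hasDerivAt (h : IsGroundState γ ξ μ φ φ' φ'') {t : ℝ} (ht : 0 < t) :
    HasDerivAt φ (φ' t) t :=
  (h.deriv1 t ht.le).hasDerivAt (Ici_mem_nhds ht)

theorem hasDerivAt' (h : IsGroundState γ ξ μ φ φ' φ'') {t : ℝ} (ht : 0 < t) :
    HasDerivAt φ' (φ'' t) t :=
  (h.deriv2 t ht.le).hasDerivAt (Ici_mem_nhds ht)

theorem continuousOn (h : IsGroundState γ ξ μ φ φ' φ'') : ContinuousOn φ (Ici 0) :=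
  fun t ht => (h.deriv1 t ht).continuousWithinAt

theorem continuousOn' (h : IsGroundState γ ξ μ φ φ' φ'') : ContinuousOn φ' (Ici 0) :=
  fun t ht => (h.deriv2 t ht).continuousWithinAt

/-- Sturm comparison with `cos (t - ξ)` bounds the eigenvalue of a positive eigenfunction. -/
theorem eigenvalue_le_five (h : IsGroundState γ ξ μ φ φ' φ'') (hξ : 2 ≤ ξ) : μ ≤ 5 := by
  by_contra! hμ
  have hpi : Real.pi / 2 < 2 := by linarith [Real.pi_lt_four]
  have hpi0 := Real.pi_pos
  have hsub : Icc (ξ - Real.pi / 2) (ξ + Real.pi / 2) ⊆ Ici 0 := fun t ht => by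
    have := ht.1
    simp only [mem_Ici]
    linarith
  have hanti : AntitoneOn (fun t => φ' t * Real.cos (t - ξ) + φ t * Real.sin (t - ξ))
      (Icc (ξ - Real.pi / 2) (ξ + Real.pi / 2)) := by
    refine antitoneOn_of_hasDerivWithinAt_nonpos
      (f' := fun t => ((t - ξ) ^ 2 - μ + 1) * φ t * Real.cos (t - ξ))
      (convex_Icc _ _) ?_ ?_ ?_
    · have h1 := h.continuousOn.mono hsub
      have h2 := h.continuousOn'.mono hsub
      fun_prop
    · intro t ht
      rw [interior_Icc] at ht ⊢
      have ht0 : 0 < t := by linarith [ht.1]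
      have hid : HasDerivAt (fun t : ℝ => t - ξ) 1 t := (hasDerivAt_id t).sub_const ξ
      have hd := ((h.hasDerivAt' ht0).mul hid.cos).add ((h.hasDerivAt ht0).mul hid.sin)
      refine (hd.congr_deriv ?_).hasDerivWithinAt
      linear_combination (-Real.cos (t - ξ)) * h.eqn t ht0.le
    · intro t ht
      rw [interior_Icc] at ht
      have hφ := h.pos t (hsub (Ioo_subset_Icc_self ht))
      have hcos : 0 ≤ Real.cos (t - ξ) :=
        Real.cos_nonneg_of_mem_Icc ⟨by linarith [ht.1], by linarith [ht.2]⟩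
      have hsq : (t - ξ) ^ 2 ≤ 4 := by nlinarith [ht.1, ht.2]
      exact mul_nonpos_of_nonpos_of_nonneg
        (mul_nonpos_of_nonpos_of_nonneg (by linarith) hφ.le) hcos
  have hle : ξ - Real.pi / 2 ≤ ξ + Real.pi / 2 := by linarith
  have key := hanti (left_mem_Icc.2 hle) (right_mem_Icc.2 hle) hle
  have hl := h.pos _ (hsub (left_mem_Icc.2 hle))
  have hr := h.pos _ (hsub (right_mem_Icc.2 hle))
  have e1 : ξ - Real.pi / 2 - ξ = -(Real.pi / 2) := by ring
  have e2 : ξ + Real.pi / 2 - ξ = Real.pi / 2 := by ring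
  simp only [e1, e2, Real.cos_neg, Real.sin_neg, Real.cos_pi_div_two, Real.sin_pi_div_two] at key
  linarith

/-- A ground state grows at least exponentially away from the boundary wherever the potential
exceeds the eigenvalue by `K ^ 2`. -/
theorem exp_growth (h : IsGroundState γ ξ μ φ φ' φ'') {K T : ℝ}
    (hγ : -(K / 2) ≤ γ) (hV : ∀ t ∈ Icc 0 T, K ^ 2 ≤ (t - ξ) ^ 2 - μ) {t : ℝ}
    (ht : t ∈ Icc 0 T) : φ 0 / 4 * Real.exp (K * t) ≤ φ t := by
  have hsub : Icc 0 T ⊆ Ici (0 : ℝ) := Icc_subset_Ici_self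
  have c1 := h.continuousOn.mono hsub
  have c2 := h.continuousOn'.mono hsub
  have hT : (0 : ℝ) ∈ Icc 0 T := ⟨le_rfl, ht.1.trans ht.2⟩
  have hφ0 := h.pos 0 self_mem_Ici
  have hexp (a s : ℝ) : HasDerivAt (fun t : ℝ => Real.exp (a * t)) (Real.exp (a * s) * a) s := by
    simpa using ((hasDerivAt_id s).const_mul a).exp
  have mono1 : MonotoneOn (fun s => (φ' s + K * φ s) * Real.exp (-K * s)) (Icc 0 T) := by
    refine monotoneOn_of_hasDerivWithinAt_nonneg
      (f' := fun s => ((s - ξ) ^ 2 - μ - K ^ 2) * φ s * Real.exp (-K * s))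
      (convex_Icc _ _) (by fun_prop) ?_ ?_
    · intro s hs
      rw [interior_Icc] at hs ⊢
      have hd := ((h.hasDerivAt' hs.1).add ((h.hasDerivAt hs.1).const_mul K)).mul (hexp (-K) s)
      refine (hd.congr_deriv ?_).hasDerivWithinAt
      simp only [Pi.add_apply]
      linear_combination (-Real.exp (-K * s)) * h.eqn s hs.1.le
    · intro s hs
      have hs' := interior_subset hs
      have := h.pos s (hsub hs')
      have := hV s hs'
      have : 0 ≤ (s - ξ) ^ 2 - μ - K ^ 2 := by linarith
      positivity
  have low (s : ℝ) (hs : s ∈ Icc 0 T) : K / 2 * φ 0 * Real.exp (K * s) ≤ φ' s + K * φ s := by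
    have h1 := mono1 hT hs hs.1
    simp only [mul_zero, Real.exp_zero, mul_one, h.bc] at h1
    have h2 : K / 2 * φ 0 ≤ (φ' s + K * φ s) * Real.exp (-K * s) := by nlinarith
    calc K / 2 * φ 0 * Real.exp (K * s)
        ≤ (φ' s + K * φ s) * Real.exp (-K * s) * Real.exp (K * s) := by gcongr
      _ = φ' s + K * φ s := by rw [mul_assoc, ← Real.exp_add]; simp
  have mono2 : MonotoneOn (fun s => (φ s - φ 0 / 4 * Real.exp (K * s)) * Real.exp (K * s))
      (Icc 0 T) := by
    refine monotoneOn_of_hasDerivWithinAt_nonneg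
      (f' := fun s => (φ' s + K * φ s - K / 2 * φ 0 * Real.exp (K * s)) * Real.exp (K * s))
      (convex_Icc _ _) (by fun_prop) ?_ ?_
    · intro s hs
      rw [interior_Icc] at hs ⊢
      have hd := ((h.hasDerivAt hs.1).sub ((hexp K s).const_mul (φ 0 / 4))).mul (hexp K s)
      refine (hd.congr_deriv ?_).hasDerivWithinAt
      simp only [Pi.sub_apply]
      ring
    · intro s hs
      have := low s (interior_subset hs)
      exact mul_nonneg (by linarith) (Real.exp_pos _).le
  have h1 := mono2 hT ht ht.1
  simp only [mul_zero, Real.exp_zero, mul_one] at h1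
  have h2 := nonneg_of_mul_nonneg_left (le_trans (by linarith) h1) (Real.exp_pos (K * t))
  linarith

end IsGroundState

/-- Given `ε ∈ (0,1)` and `γ ∈ ℝ`, there exists `C > 0` such that for all `ξ ≥ C`
and every ground state `φ` of `H[γ,ξ]`, `|φ(0)|² ≤ C·exp(−εξ/2)`. -/
theorem groundState_boundary_decay :
    ∀ ε ∈ Ioo (0:ℝ) 1, ∀ γ : ℝ, ∃ C > (0:ℝ), ∀ ξ : ℝ, C ≤ ξ →
      ∀ φ φ' φ'' : ℝ → ℝ, IsGroundState γ ξ (mu1 γ ξ) φ φ' φ'' →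
        (φ 0) ^ 2 ≤ C * Real.exp (-(ε * ξ) / 2) := by
  rintro ε ⟨-, hε⟩ γ
  refine ⟨32 + 4 * |γ|, by positivity, fun ξ hξ φ φ' φ'' h => ?_⟩
  have hγ := abs_nonneg γ
  have hμ := h.eigenvalue_le_five (by linarith)
  have hgrow (t : ℝ) (ht : t ∈ Icc (0 : ℝ) 1) :
      φ 0 / 4 * Real.exp (ξ / 2 * t) ≤ φ t := by
    refine h.exp_growth (T := 1) (by linarith [neg_abs_le γ]) ?_ ht
    intro s hs
    nlinarith [hs.1, hs.2]
  have hφ0 := h.pos 0 self_mem_Ici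
  have hpt (t : ℝ) (ht : t ∈ Ioc (1 / 2 : ℝ) 1) :
      φ 0 ^ 2 / 16 * Real.exp (ξ / 2) ≤ φ t ^ 2 := by
    calc φ 0 ^ 2 / 16 * Real.exp (ξ / 2)
        ≤ φ 0 ^ 2 / 16 * Real.exp (ξ / 2 * t + ξ / 2 * t) := by
          gcongr
          nlinarith [ht.1]
      _ = (φ 0 / 4 * Real.exp (ξ / 2 * t)) ^ 2 := by rw [Real.exp_add]; ring
      _ ≤ φ t ^ 2 := by
          gcongr
          exact hgrow t ⟨by linarith [ht.1], ht.2⟩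
  have hsub : Ioc (1 / 2 : ℝ) 1 ⊆ Ioi 0 := fun t ht => lt_trans (by norm_num) ht.1
  have hint : φ 0 ^ 2 / 32 * Real.exp (ξ / 2) ≤ 1 := by
    calc φ 0 ^ 2 / 32 * Real.exp (ξ / 2)
        = ∫ _ in Ioc (1 / 2 : ℝ) 1, φ 0 ^ 2 / 16 * Real.exp (ξ / 2) := by
          rw [setIntegral_const, Measure.real, Real.volume_Ioc, smul_eq_mul,
            ENNReal.toReal_ofReal (by norm_num)]
          ring
      _ ≤ ∫ t in Ioc (1 / 2 : ℝ) 1, φ t ^ 2 :=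
          setIntegral_mono_on (integrableOn_const (by simp)) (h.memL2.mono_set hsub)
            measurableSet_Ioc hpt
      _ ≤ ∫ t in Ioi (0 : ℝ), φ t ^ 2 :=
          setIntegral_mono_set h.memL2 (ae_of_all _ fun t => sq_nonneg _) hsub.eventuallyLE
      _ = 1 := h.normalized
  calc φ 0 ^ 2 = 32 * (φ 0 ^ 2 / 32 * Real.exp (ξ / 2)) * Real.exp (-(ξ / 2)) := by
        rw [Real.exp_neg]
        field_simp
    _ ≤ 32 * 1 * Real.exp (-(ξ / 2)) := by gcongr
    _ ≤ (32 + 4 * |γ|) * Real.exp (-(ε * ξ) / 2) := by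
        gcongr
        · linarith
        · nlinarith
end

section
/- For every γ ∈ ℝ there exists a unique ξ* ∈ ℝ such that μ⁽¹⁾(γ,ξ*) = Θ(γ); moreover this minimizer ξ* is strictly positive and satisfies ξ*² = Θ(γ) + γ². -/
open MeasureTheory Set Filter

open scoped Topology

/-- The moments `∫₀^∞ s^p exp(-s²/4 - x s) ds`, the building blocks of the integral
representation of the parabolic cylinder functions. -/
noncomputable def weberMoment (p x : ℝ) : ℝ :=
  ∫ s in Ioi (0:ℝ), s ^ p * Real.exp (-s ^ 2 / 4 - x * s)

lemma rpow_mul_exp_le {p P x R s : ℝ} (hp : 0 ≤ p) (hpP : p ≤ P) (hx : |x| ≤ R) (hs : 0 < s) :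
    s ^ p * Real.exp (-s ^ 2 / 4 - x * s) ≤
      Real.exp (2 * R ^ 2) * (s ^ (0:ℝ) * Real.exp (-(1 / 8) * s ^ 2) +
        s ^ P * Real.exp (-(1 / 8) * s ^ 2)) := by
  have h1 : s ^ p ≤ s ^ (0:ℝ) + s ^ P := by
    rw [Real.rpow_zero]
    rcases le_total s 1 with h | h
    · linarith [Real.rpow_le_one hs.le h hp, Real.rpow_nonneg hs.le P]
    · linarith [Real.rpow_le_rpow_of_exponent_le h hpP]
  have h2 : Real.exp (-s ^ 2 / 4 - x * s) ≤ Real.exp (2 * R ^ 2) * Real.exp (-(1 / 8) * s ^ 2) := by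
    rw [← Real.exp_add]
    apply Real.exp_le_exp.2
    have := (abs_le.1 hx).1
    nlinarith [sq_nonneg (s - 4 * R), mul_nonneg (by linarith : 0 ≤ x + R) hs.le]
  calc _ ≤ (s ^ (0:ℝ) + s ^ P) * (Real.exp (2 * R ^ 2) * Real.exp (-(1 / 8) * s ^ 2)) := by
        gcongr
    _ = _ := by ring

lemma integrableOn_gaussian_majorant {P : ℝ} (hP : 0 ≤ P) (C : ℝ) :
    IntegrableOn (fun s : ℝ => C * (s ^ (0:ℝ) * Real.exp (-(1 / 8) * s ^ 2) +
        s ^ P * Real.exp (-(1 / 8) * s ^ 2))) (Ioi 0) :=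
  ((integrableOn_rpow_mul_exp_neg_mul_sq (by norm_num) (by norm_num)).add
    (integrableOn_rpow_mul_exp_neg_mul_sq (by norm_num) (by linarith))).const_mul _

lemma aestronglyMeasurable_weber (p x : ℝ) :
    AEStronglyMeasurable (fun s : ℝ => s ^ p * Real.exp (-s ^ 2 / 4 - x * s))
      (volume.restrict (Ioi 0)) := by
  have : Measurable (fun s : ℝ => s ^ p * Real.exp (-s ^ 2 / 4 - x * s)) := by fun_prop
  exact this.aestronglyMeasurable

lemma integrableOn_weber {p : ℝ} (hp : 0 ≤ p) (x : ℝ) :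
    IntegrableOn (fun s : ℝ => s ^ p * Real.exp (-s ^ 2 / 4 - x * s)) (Ioi 0) := by
  refine Integrable.mono' (integrableOn_gaussian_majorant hp (Real.exp (2 * |x| ^ 2)))
    (aestronglyMeasurable_weber p x) ?_
  filter_upwards [ae_restrict_mem measurableSet_Ioi] with s hs
  have hs' : 0 < s := hs
  rw [Real.norm_of_nonneg (by positivity)]
  exact rpow_mul_exp_le hp le_rfl le_rfl hs

lemma weberMoment_pos {p : ℝ} (hp : 0 ≤ p) (x : ℝ) : 0 < weberMoment p x := by
  unfold weberMoment
  rw [setIntegral_pos_iff_support_of_nonneg_ae]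
  · have : Function.support (fun s : ℝ => s ^ p * Real.exp (-s ^ 2 / 4 - x * s)) ∩ Ioi 0
        = Ioi 0 := by
      apply inter_eq_right.2
      intro s hs
      have hs' : 0 < s := hs
      simp only [Function.mem_support]
      positivity
    rw [this]
    simp
  · filter_upwards [ae_restrict_mem measurableSet_Ioi] with s hs
    have hs' : 0 < s := hs
    simp only [Pi.zero_apply]
    positivity
  · exact integrableOn_weber hp x

lemma hasDerivAt_weberMoment {p : ℝ} (hp : 0 ≤ p) (x : ℝ) :
    HasDerivAt (weberMoment p) (-weberMoment (p + 1) x) x := by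
  have key := (hasDerivAt_integral_of_dominated_loc_of_deriv_le (𝕜 := ℝ)
    (μ := volume.restrict (Ioi (0:ℝ))) (x₀ := x) (s := Metric.ball x 1)
    (F := fun x s => s ^ p * Real.exp (-s ^ 2 / 4 - x * s))
    (F' := fun x s => -(s ^ (p + 1) * Real.exp (-s ^ 2 / 4 - x * s)))
    (bound := fun s : ℝ => Real.exp (2 * (|x| + 1) ^ 2) *
      (s ^ (0:ℝ) * Real.exp (-(1 / 8) * s ^ 2) + s ^ (p + 1) * Real.exp (-(1 / 8) * s ^ 2)))
    (Metric.ball_mem_nhds x one_pos)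
    (Eventually.of_forall fun y => aestronglyMeasurable_weber p y)
    (integrableOn_weber hp x) (aestronglyMeasurable_weber (p + 1) x).neg ?_
    (integrableOn_gaussian_majorant (by linarith) _) ?_).2
  · rw [integral_neg] at key
    exact key
  · filter_upwards [ae_restrict_mem measurableSet_Ioi] with s hs y hy
    have hs' : 0 < s := hs
    rw [norm_neg, Real.norm_of_nonneg (by positivity)]
    refine rpow_mul_exp_le (by linarith) le_rfl ?_ hs
    rw [Metric.mem_ball, Real.dist_eq] at hy
    linarith [abs_sub_abs_le_abs_sub y x]
  · filter_upwards [ae_restrict_mem measurableSet_Ioi] with s hs y hy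
    have h1 : HasDerivAt (fun y : ℝ => -s ^ 2 / 4 - y * s) (-s) y := by
      simpa using ((hasDerivAt_id y).mul_const s).const_sub (-s ^ 2 / 4)
    have h2 := h1.exp.const_mul (s ^ p)
    refine h2.congr_deriv ?_
    rw [Real.rpow_add_one (ne_of_gt hs)]
    ring

lemma continuousOn_weberMoment :
    ContinuousOn (fun z : ℝ × ℝ => weberMoment z.1 z.2) {z | 0 ≤ z.1} := by
  rintro ⟨p, x⟩ (hp : 0 ≤ p)
  have hnear : ∀ᶠ z : ℝ × ℝ in 𝓝[{z | 0 ≤ z.1}] (p, x), 0 ≤ z.1 ∧ z.1 ≤ p + 1 ∧ |z.2| ≤ |x| + 1 := by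
    have h1 : ∀ᶠ z : ℝ × ℝ in 𝓝 (p, x), z.1 < p + 1 :=
      continuous_fst.continuousAt.eventually_lt continuousAt_const (by simp)
    have h2 : ∀ᶠ z : ℝ × ℝ in 𝓝 (p, x), |z.2| < |x| + 1 :=
      continuous_snd.abs.continuousAt.eventually_lt continuousAt_const (by simp)
    filter_upwards [self_mem_nhdsWithin, nhdsWithin_le_nhds h1, nhdsWithin_le_nhds h2]
      with z a b c using ⟨a, b.le, c.le⟩
  refine continuousWithinAt_of_dominated (μ := volume.restrict (Ioi (0:ℝ)))
    (bound := fun s : ℝ => Real.exp (2 * (|x| + 1) ^ 2) *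
      (s ^ (0:ℝ) * Real.exp (-(1 / 8) * s ^ 2) + s ^ (p + 1) * Real.exp (-(1 / 8) * s ^ 2)))
    (Eventually.of_forall fun z => aestronglyMeasurable_weber z.1 z.2) ?_
    (integrableOn_gaussian_majorant (by linarith) _) ?_
  · filter_upwards [hnear] with z hz
    filter_upwards [ae_restrict_mem measurableSet_Ioi] with s hs
    have hs' : 0 < s := hs
    rw [Real.norm_of_nonneg (by positivity)]
    exact rpow_mul_exp_le hz.1 hz.2.1 hz.2.2 hs
  · filter_upwards [ae_restrict_mem measurableSet_Ioi] with s hs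
    have hs' : s ≠ 0 := ne_of_gt hs
    apply Continuous.continuousWithinAt
    refine Continuous.mul ?_ (by fun_prop)
    exact continuous_iff_continuousAt.2 fun z =>
      (Real.continuousAt_const_rpow hs').comp continuous_fst.continuousAt

lemma tendsto_rpow_mul_exp_weber {p : ℝ} (hp : 0 ≤ p) (x : ℝ) :
    Tendsto (fun s : ℝ => s ^ p * Real.exp (-s ^ 2 / 4 - x * s)) atTop (𝓝 0) := by
  have h (P : ℝ) : Tendsto (fun s : ℝ => s ^ P * Real.exp (-(1 / 8) * s ^ 2)) atTop (𝓝 0) := by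
    refine (rpow_mul_exp_neg_mul_sq_isLittleO_exp_neg (by norm_num) P).trans_tendsto ?_
    exact Real.tendsto_exp_atBot.comp (tendsto_id.const_mul_atTop_of_neg (by norm_num))
  have h2 := ((h 0).add (h p)).const_mul (Real.exp (2 * |x| ^ 2))
  simp only [add_zero, mul_zero] at h2
  refine squeeze_zero' ?_ ?_ h2
  · filter_upwards [eventually_gt_atTop 0] with s hs
    positivity
  · filter_upwards [eventually_gt_atTop 0] with s hs
    exact rpow_mul_exp_le hp le_rfl le_rfl hs

lemma weberMoment_recurrence {p : ℝ} (hp : 0 ≤ p) (x : ℝ) :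
    (p + 1) * weberMoment p x = weberMoment (p + 2) x / 2 + x * weberMoment (p + 1) x := by
  have h0 := integrableOn_weber hp x
  have h1 := integrableOn_weber (p := p + 1) (by linarith) x
  have h2 := integrableOn_weber (p := p + 2) (by linarith) x
  have key := integral_Ioi_of_hasDerivAt_of_tendsto (a := 0) (m := 0)
    (f := fun s : ℝ => s ^ (p + 1) * Real.exp (-s ^ 2 / 4 - x * s))
    (f' := fun s : ℝ => (p + 1) * (s ^ p * Real.exp (-s ^ 2 / 4 - x * s)) -
      (1 / 2 * (s ^ (p + 2) * Real.exp (-s ^ 2 / 4 - x * s)) +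
        x * (s ^ (p + 1) * Real.exp (-s ^ 2 / 4 - x * s)))) ?_ ?_
    ((h0.const_mul _).sub ((h2.const_mul _).add (h1.const_mul _)))
    (tendsto_rpow_mul_exp_weber (by linarith) x)
  · have h3 : IntegrableOn (fun s : ℝ => 1 / 2 * (s ^ (p + 2) * Real.exp (-s ^ 2 / 4 - x * s)) +
        x * (s ^ (p + 1) * Real.exp (-s ^ 2 / 4 - x * s))) (Ioi 0) :=
      (h2.const_mul _).add (h1.const_mul _)
    rw [integral_sub (h0.const_mul _) h3, integral_add (h2.const_mul _) (h1.const_mul _), integral_const_mul, integral_const_mul,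
      integral_const_mul, Real.zero_rpow (by linarith)] at key
    unfold weberMoment
    linarith
  · apply ContinuousAt.continuousWithinAt
    refine ContinuousAt.mul (Real.continuousAt_rpow_const _ _ (Or.inr (by linarith))) ?_
    fun_prop
  · intro s hs
    have hs' : s ≠ 0 := ne_of_gt hs
    have e1 : HasDerivAt (fun s : ℝ => -s ^ 2 / 4 - x * s) (-s / 2 - x) s := by
      refine (((hasDerivAt_pow 2 s).fun_neg.div_const 4).fun_sub
        ((hasDerivAt_id s).const_mul x)).congr_deriv ?_
      push_cast
      ring
    have e2 := (Real.hasDerivAt_rpow_const (p := p + 1) (Or.inl hs')).fun_mul e1.exp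
    refine e2.congr_deriv ?_
    rw [show p + 2 = p + 1 + 1 by ring, Real.rpow_add_one hs' (p + 1), add_sub_cancel_right]
    ring

section Weber

/-- The polynomial-growth factor of the decaying solution of `-V'' + x² V = (1 - 2p) V`. -/
noncomputable def weberFactor (p x : ℝ) : ℝ :=
  weberMoment (p + 1) x / 2 + x * weberMoment p x

/-- The solution of `-V'' + x² V = (1 - 2p) V` decaying at `+∞`. -/
noncomputable def weberSol (p x : ℝ) : ℝ := Real.exp (-x ^ 2 / 2) * weberFactor p x

/-- The logarithmic derivative of `weberSol`. -/
noncomputable def weberLogDeriv (p x : ℝ) : ℝ := -x - p * weberMoment p x / weberFactor p x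

variable {p : ℝ}

lemma hasDerivAt_weberFactor (hp : 0 ≤ p) (x : ℝ) :
    HasDerivAt (weberFactor p) (-(p * weberMoment p x)) x := by
  have h := ((hasDerivAt_weberMoment (p := p + 1) (by linarith) x).div_const 2).fun_add
    ((hasDerivAt_id x).fun_mul (hasDerivAt_weberMoment hp x))
  refine h.congr_deriv ?_
  have := weberMoment_recurrence hp x
  rw [show p + 1 + 1 = p + 2 by ring]
  simp only [id]
  linarith

lemma antitone_weberMoment (hp : 0 ≤ p) : Antitone (weberMoment p) :=
  antitone_of_hasDerivAt_nonpos (hasDerivAt_weberMoment hp)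
    fun x => neg_nonpos.2 (weberMoment_pos (by linarith) x).le

lemma antitone_weberFactor (hp : 0 ≤ p) : Antitone (weberFactor p) :=
  antitone_of_hasDerivAt_nonpos (hasDerivAt_weberFactor hp)
    fun x => neg_nonpos.2 (mul_nonneg hp (weberMoment_pos hp x).le)

lemma weberFactor_pos (hp : 0 ≤ p) (x : ℝ) : 0 < weberFactor p x := by
  have h : 0 < weberFactor p (max x 0) := by
    have h1 := weberMoment_pos (p := p + 1) (by linarith) (max x 0)
    have h2 := weberMoment_pos hp (max x 0)
    have h3 : 0 ≤ max x 0 := le_max_right _ _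
    unfold weberFactor
    positivity
  exact h.trans_le (antitone_weberFactor hp (le_max_left _ _))

lemma weberSol_sq (p x : ℝ) : weberSol p x ^ 2 = weberFactor p x ^ 2 * Real.exp (-x ^ 2) := by
  unfold weberSol
  rw [mul_pow, ← Real.exp_nat_mul, mul_comm]
  congr 2
  push_cast
  ring

lemma weberSol_pos (hp : 0 ≤ p) (x : ℝ) : 0 < weberSol p x :=
  mul_pos (Real.exp_pos _) (weberFactor_pos hp x)

lemma hasDerivAt_weberSol (hp : 0 ≤ p) (x : ℝ) :
    HasDerivAt (weberSol p) (weberSol p x * weberLogDeriv p x) x := by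
  have e1 : HasDerivAt (fun x : ℝ => -x ^ 2 / 2) (-x) x := by
    refine ((hasDerivAt_pow 2 x).fun_neg.div_const 2).congr_deriv ?_
    push_cast
    ring
  refine (e1.exp.fun_mul (hasDerivAt_weberFactor hp x)).congr_deriv ?_
  have := (weberFactor_pos hp x).ne'
  unfold weberSol weberLogDeriv
  field_simp
  ring

lemma hasDerivAt_weberLogDeriv (hp : 0 ≤ p) (x : ℝ) :
    HasDerivAt (weberLogDeriv p) (x ^ 2 - (1 - 2 * p) - weberLogDeriv p x ^ 2) x := by
  have hB := (weberFactor_pos hp x).ne'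
  refine ((hasDerivAt_id x).fun_neg.fun_sub (((hasDerivAt_weberMoment hp x).const_mul p).fun_div
    (hasDerivAt_weberFactor hp x) hB)).congr_deriv ?_
  have h : weberMoment (p + 1) x = 2 * (weberFactor p x - x * weberMoment p x) := by
    unfold weberFactor
    ring
  rw [h]
  unfold weberLogDeriv
  field_simp
  ring

lemma continuous_weberLogDeriv (hp : 0 ≤ p) : Continuous (weberLogDeriv p) :=
  continuous_iff_continuousAt.2 fun x => (hasDerivAt_weberLogDeriv hp x).continuousAt

lemma continuous_weberSol (hp : 0 ≤ p) : Continuous (weberSol p) :=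
  continuous_iff_continuousAt.2 fun x => (hasDerivAt_weberSol hp x).continuousAt

lemma continuousOn_weberLogDeriv :
    ContinuousOn (fun z : ℝ × ℝ => weberLogDeriv z.1 z.2) {z | 0 ≤ z.1} := by
  have h1 : ContinuousOn (fun z : ℝ × ℝ => weberMoment (z.1 + 1) z.2) {z | 0 ≤ z.1} :=
    continuousOn_weberMoment.comp (f := fun z : ℝ × ℝ => (z.1 + 1, z.2)) (by fun_prop)
      fun z (hz : 0 ≤ z.1) => (by positivity : 0 ≤ z.1 + 1)
  have hB : ContinuousOn (fun z : ℝ × ℝ => weberFactor z.1 z.2) {z | 0 ≤ z.1} :=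
    (h1.div_const 2).add (continuousOn_snd.mul continuousOn_weberMoment)
  exact continuousOn_snd.neg.sub ((continuousOn_fst.mul continuousOn_weberMoment).div hB
    fun z hz => (weberFactor_pos hz z.2).ne')

lemma neg_weberLogDeriv_le (hp : 0 ≤ p) {x : ℝ} (hx : 1 ≤ x) : -weberLogDeriv p x ≤ x + p := by
  have h1 := weberMoment_pos hp x
  have h2 := weberMoment_pos (p := p + 1) (by linarith) x
  have h3 : weberMoment p x / weberFactor p x ≤ 1 := by
    rw [div_le_one (weberFactor_pos hp x)]
    unfold weberFactor
    nlinarith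
  unfold weberLogDeriv
  rw [mul_div_assoc]
  nlinarith

/-- `V² h'`, where `V` is the decaying solution and `h` its logarithmic derivative. -/
noncomputable def weberSlope (p x : ℝ) : ℝ :=
  (x ^ 2 - (1 - 2 * p) - weberLogDeriv p x ^ 2) * weberSol p x ^ 2

lemma hasDerivAt_weberSlope (hp : 0 ≤ p) (x : ℝ) :
    HasDerivAt (weberSlope p) (2 * x * weberSol p x ^ 2) x := by
  refine ((((hasDerivAt_pow 2 x).sub_const (1 - 2 * p)).fun_sub
    ((hasDerivAt_weberLogDeriv hp x).fun_pow 2)).fun_mul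
    ((hasDerivAt_weberSol hp x).fun_pow 2)).congr_deriv ?_
  push_cast
  ring

lemma continuous_weberSlope (hp : 0 ≤ p) : Continuous (weberSlope p) :=
  continuous_iff_continuousAt.2 fun x => (hasDerivAt_weberSlope hp x).continuousAt

lemma strictMonoOn_weberSlope (hp : 0 ≤ p) : StrictMonoOn (weberSlope p) (Ici 0) := by
  refine strictMonoOn_of_deriv_pos (convex_Ici 0) (continuous_weberSlope hp).continuousOn ?_
  intro x hx
  rw [interior_Ici] at hx
  have hx' : 0 < x := hx
  rw [(hasDerivAt_weberSlope hp x).deriv]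
  have := weberSol_pos hp x
  positivity

lemma strictAntiOn_weberSlope (hp : 0 ≤ p) : StrictAntiOn (weberSlope p) (Iic 0) := by
  refine strictAntiOn_of_deriv_neg (convex_Iic 0) (continuous_weberSlope hp).continuousOn ?_
  intro x hx
  rw [interior_Iic] at hx
  have hx' : x < 0 := hx
  rw [(hasDerivAt_weberSlope hp x).deriv]
  have := weberSol_pos hp x
  have : 0 < weberSol p x ^ 2 := by positivity
  nlinarith

lemma weberSlope_le (hp : 0 ≤ p) {x : ℝ} (hx : 0 ≤ x) :
    weberSlope p x ≤ 2 * p * weberFactor p 0 ^ 2 * Real.exp (-x ^ 2) := by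
  have hA := weberMoment_pos hp x
  have hB := weberFactor_pos hp x
  have hB0 : weberFactor p x ≤ weberFactor p 0 := antitone_weberFactor hp hx
  have h : weberSlope p x = ((2 * p - 1) * weberFactor p x ^ 2 -
      2 * x * p * weberMoment p x * weberFactor p x - p ^ 2 * weberMoment p x ^ 2) *
        Real.exp (-x ^ 2) := by
    unfold weberSlope
    rw [weberSol_sq]
    unfold weberLogDeriv
    field_simp
    ring
  rw [h]
  gcongr
  have h1 : 0 ≤ 2 * x * p * weberMoment p x * weberFactor p x := by positivity
  have h2 : p * weberFactor p x ^ 2 ≤ p * weberFactor p 0 ^ 2 := by gcongr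
  nlinarith [sq_nonneg (p * weberMoment p x), sq_nonneg (weberFactor p x)]

lemma weberSlope_neg (hp : 0 ≤ p) {x : ℝ} (hx : 0 ≤ x) : weberSlope p x < 0 := by
  have hlim : Tendsto (fun y : ℝ => 2 * p * weberFactor p 0 ^ 2 * Real.exp (-y ^ 2)) atTop
      (𝓝 0) := by
    have h : Tendsto (fun y : ℝ => Real.exp (-y ^ 2)) atTop (𝓝 0) :=
      Real.tendsto_exp_atBot.comp (tendsto_neg_atTop_atBot.comp (tendsto_pow_atTop two_ne_zero))
    simpa using h.const_mul (2 * p * weberFactor p 0 ^ 2)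
  have h1 : weberSlope p (x + 1) ≤ 0 := by
    refine ge_of_tendsto hlim ?_
    filter_upwards [eventually_ge_atTop (x + 1)] with y hy
    exact ((strictMonoOn_weberSlope hp).monotoneOn (by simp; linarith) (by simp; linarith) hy).trans
      (weberSlope_le hp (by linarith))
  exact (strictMonoOn_weberSlope hp hx (by simp; linarith) (by linarith)).trans_le h1

/-- A critical point of `weberLogDeriv p` at a negative abscissa is its strict global maximum. -/
lemma weberLogDeriv_lt_of_ne (hp : 0 ≤ p) {x₀ : ℝ} (hx₀ : x₀ < 0)
    (hcrit : x₀ ^ 2 - (1 - 2 * p) - weberLogDeriv p x₀ ^ 2 = 0) {x : ℝ} (hx : x ≠ x₀) :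
    weberLogDeriv p x < weberLogDeriv p x₀ := by
  have h0 : weberSlope p x₀ = 0 := by simp [weberSlope, hcrit]
  have hV (y : ℝ) : 0 < weberSol p y ^ 2 := pow_pos (weberSol_pos hp y) 2
  rcases lt_or_gt_of_ne hx with h | h
  · refine strictMonoOn_of_deriv_pos (convex_Iic x₀) (continuous_weberLogDeriv hp).continuousOn
      ?_ h.le self_mem_Iic h
    intro y hy
    rw [interior_Iic] at hy
    have hy' : y < x₀ := hy
    rw [(hasDerivAt_weberLogDeriv hp y).deriv]
    have := strictAntiOn_weberSlope hp (hy'.trans hx₀).le hx₀.le hy'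
    rw [h0] at this
    exact pos_of_mul_pos_left this (hV y).le
  · refine strictAntiOn_of_deriv_neg (convex_Ici x₀) (continuous_weberLogDeriv hp).continuousOn
      ?_ self_mem_Ici h.le h
    intro y hy
    rw [interior_Ici] at hy
    have hy' : x₀ < y := hy
    rw [(hasDerivAt_weberLogDeriv hp y).deriv]
    have : weberSlope p y < 0 := by
      rcases le_total 0 y with h' | h'
      · exact weberSlope_neg hp h'
      · rw [← h0]
        exact strictAntiOn_weberSlope hp hx₀.le h' hy'
    exact neg_of_mul_neg_left this (hV y).le

/-- For every `γ` there is an energy level `1 - 2p < 1` whose logarithmic derivative has the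
critical value `γ`, at a negative abscissa. -/
lemma exists_critical_weberLogDeriv (γ : ℝ) :
    ∃ p x₀ : ℝ, 0 < p ∧ x₀ < 0 ∧ weberLogDeriv p x₀ = γ ∧ x₀ ^ 2 = 1 - 2 * p + γ ^ 2 := by
  set a : ℝ := √(1 + γ ^ 2) with ha
  have ha2 : a ^ 2 = 1 + γ ^ 2 := Real.sq_sqrt (by positivity)
  have ha0 : 0 ≤ a := Real.sqrt_nonneg _
  have hγa : γ < a := lt_of_pow_lt_pow_left₀ 2 ha0 (by linarith)
  set P : ℝ → ℝ := fun x => (1 + γ ^ 2 - x ^ 2) / 2 with hP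
  have hcont : ContinuousOn (fun x => weberLogDeriv (P x) x) (Icc (-a) 0) := by
    refine continuousOn_weberLogDeriv.comp (f := fun x => (P x, x)) (by fun_prop) ?_
    intro x hx
    have : 0 ≤ (1 + γ ^ 2 - x ^ 2) / 2 := by nlinarith [hx.1, hx.2]
    exact this
  have hleft : weberLogDeriv (P (-a)) (-a) = a := by
    have : P (-a) = 0 := by simp [hP, ha2]
    rw [this]
    simp [weberLogDeriv]
  have hP0 : 0 < P 0 := by
    simp only [hP]
    nlinarith [sq_nonneg γ]
  have hright : weberLogDeriv (P 0) 0 < γ := by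
    have h1 : weberLogDeriv (P 0) 0 < 0 := by
      have := weberMoment_pos hP0.le 0
      have := weberFactor_pos hP0.le 0
      have : 0 < P 0 * weberMoment (P 0) 0 / weberFactor (P 0) 0 := by positivity
      unfold weberLogDeriv
      linarith
    have h2 := weberSlope_neg hP0.le le_rfl
    have h3 := neg_of_mul_neg_left h2 (pow_pos (weberSol_pos hP0.le 0) 2).le
    simp only [hP] at h1 h3 ⊢
    nlinarith
  obtain ⟨x, hx, hxγ⟩ := intermediate_value_Icc' (by linarith) hcont
    (show γ ∈ Icc _ _ from ⟨hright.le, by simpa only [hleft] using hγa.le⟩)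
  have hx0 : x < 0 := lt_of_le_of_ne hx.2 (by rintro rfl; exact hright.ne hxγ)
  have hxa : -a < x := lt_of_le_of_ne hx.1 (by rintro rfl; exact hγa.ne' (hleft.symm.trans hxγ))
  refine ⟨P x, x, ?_, hx0, hxγ, ?_⟩
  · have : 0 < (1 + γ ^ 2 - x ^ 2) / 2 := by nlinarith
    exact this
  · simp only [hP]
    ring

lemma integral_sq_mul_deriv_of_primitive {f f' h h' : ℝ → ℝ} {T : ℝ} (hT : 0 ≤ T)
    (hf' : IntervalIntegrable f' volume 0 T)
    (hf : ∀ t ∈ Icc 0 T, f t = f 0 + ∫ s in (0:ℝ)..t, f' s)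
    (hh : ∀ t, HasDerivAt h (h' t) t) (hh' : Continuous h') :
    ∫ t in (0:ℝ)..T, (2 * f t * f' t * h t + f t ^ 2 * h' t) =
      f T ^ 2 * h T - f 0 ^ 2 * h 0 := by
  set F : ℝ → ℝ := fun t => ∫ s in (0:ℝ)..t, f' s with hF
  set H : ℝ → ℝ := fun t => ∫ s in (0:ℝ)..t, h' s with hH
  have hFac : AbsolutelyContinuousOnInterval F 0 T :=
    hf'.absolutelyContinuousOnInterval_intervalIntegral (by simp)
  have hHac : AbsolutelyContinuousOnInterval H 0 T :=
    (hh'.intervalIntegrable 0 T).absolutelyContinuousOnInterval_intervalIntegral (by simp)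
  have hHh (t : ℝ) : h t = h 0 + H t := by
    simp only [hH]
    rw [intervalIntegral.integral_eq_sub_of_hasDerivAt (fun t _ => hh t)
      (hh'.intervalIntegrable 0 t)]
    ring
  have hconst (c : ℝ) : AbsolutelyContinuousOnInterval (fun _ : ℝ => c) 0 T :=
    (LipschitzWith.const c).lipschitzOnWith.absolutelyContinuousOnInterval
  have hfac := (hconst (f 0)).fun_add hFac
  have hhac := (hconst (h 0)).fun_add hHac
  have hac := (hfac.fun_mul hfac).fun_mul hhac
  have key := hac.integral_deriv_eq_sub
  have hF0 : F 0 = 0 := by simp [hF]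
  have hH0 : H 0 = 0 := by simp [hH]
  rw [← hHh T, ← hf T ⟨hT, le_rfl⟩, hF0, hH0, add_zero, add_zero] at key
  rw [sq, sq, ← key]
  apply intervalIntegral.integral_congr_ae
  filter_upwards [hf'.ae_hasDerivAt_integral] with t ht htT
  have ht' : t ∈ uIcc 0 T := uIoc_subset_uIcc htT
  have dF : HasDerivAt (fun t => f 0 + F t) (f' t) t := (ht ht' 0 (by simp)).const_add _
  have dH : HasDerivAt (fun t => h 0 + H t) (h' t) t := by
    simpa only [← hHh] using hh t
  rw [((dF.fun_mul dF).fun_mul dH).deriv, ← hHh t, hF, ← hf t (by rwa [uIcc_of_le hT] at ht')]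
  ring

lemma AdmissibleHL.intervalIntegral_ge {u u' : ℝ → ℂ} (hu : AdmissibleHL u u') {h h' : ℝ → ℝ}
    (hh : ∀ t, HasDerivAt h (h' t) t) (hh' : Continuous h') {T : ℝ} (hT : 0 ≤ T) :
    ‖u T‖ ^ 2 * h T - ‖u 0‖ ^ 2 * h 0 ≤
      ∫ t in (0:ℝ)..T, (‖u' t‖ ^ 2 + (h' t + h t ^ 2) * ‖u t‖ ^ 2) := by
  have hsq (z : ℂ) : ‖z‖ ^ 2 = z.re ^ 2 + z.im ^ 2 := by
    rw [← Complex.normSq_eq_norm_sq, Complex.normSq_apply]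
    ring
  have hcont : Continuous h := continuous_iff_continuousAt.2 fun t => (hh t).continuousAt
  have hloc := hu.locInt T hT
  have hre : IntervalIntegrable (fun t => (u' t).re) volume 0 T := ⟨hloc.1.re, hloc.2.re⟩
  have him : IntervalIntegrable (fun t => (u' t).im) volume 0 T := ⟨hloc.1.im, hloc.2.im⟩
  have hucont : ContinuousOn u (uIcc 0 T) := by
    rw [uIcc_of_le hT]
    exact hu.cont.mono Icc_subset_Ici_self
  have hrec : ContinuousOn (fun t => (u t).re) (uIcc 0 T) :=
    Complex.continuous_re.comp_continuousOn hucont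
  have himc : ContinuousOn (fun t => (u t).im) (uIcc 0 T) :=
    Complex.continuous_im.comp_continuousOn hucont
  have h1 := integral_sq_mul_deriv_of_primitive (f := fun t => (u t).re) hT hre (fun t ht => by
    have e := congrArg Complex.re (hu.ac t ht.1)
    have e2 := Complex.reCLM.intervalIntegral_comp_comm (hu.locInt t ht.1)
    simp only [Complex.reCLM_apply] at e2
    rw [e, e2, Complex.add_re]) hh hh'
  have h2 := integral_sq_mul_deriv_of_primitive (f := fun t => (u t).im) hT him (fun t ht => by
    have e := congrArg Complex.im (hu.ac t ht.1)
    have e2 := Complex.imCLM.intervalIntegral_comp_comm (hu.locInt t ht.1)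
    simp only [Complex.imCLM_apply] at e2
    rw [e, e2, Complex.add_im]) hh hh'
  have i1 : IntervalIntegrable (fun t => 2 * (u t).re * (u' t).re * h t + (u t).re ^ 2 * h' t)
      volume 0 T :=
    ((hre.continuousOn_mul (hrec.const_mul 2)).mul_continuousOn hcont.continuousOn).add
      ((hrec.pow 2).mul hh'.continuousOn).intervalIntegrable
  have i2 : IntervalIntegrable (fun t => 2 * (u t).im * (u' t).im * h t + (u t).im ^ 2 * h' t)
      volume 0 T :=
    ((him.continuousOn_mul (himc.const_mul 2)).mul_continuousOn hcont.continuousOn).add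
      ((himc.pow 2).mul hh'.continuousOn).intervalIntegrable
  have i3 : IntervalIntegrable (fun t => ‖u' t‖ ^ 2 + (h' t + h t ^ 2) * ‖u t‖ ^ 2)
      volume 0 T := by
    refine IntervalIntegrable.add ?_ ?_
    · rw [intervalIntegrable_iff_integrableOn_Ioc_of_le hT]
      exact hu.memL2'.mono_set Ioc_subset_Ioi_self
    · exact ((hh'.add (hcont.pow 2)).continuousOn.mul (hucont.norm.pow 2)).intervalIntegrable
  have h3 := intervalIntegral.integral_mono_on hT (i1.add i2) i3 (fun t _ => by
    rw [hsq, hsq]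
    nlinarith [sq_nonneg ((u' t).re - h t * (u t).re), sq_nonneg ((u' t).im - h t * (u t).im)])
  rw [intervalIntegral.integral_add i1 i2, h1, h2] at h3
  rw [hsq, hsq]
  linarith

lemma not_eventually_const_le_of_integrableOn_Ioi {f : ℝ → ℝ} (hf : IntegrableOn f (Ioi 0))
    {ε : ℝ} (hε : 0 < ε) : ¬ ∀ᶠ t in atTop, ε ≤ f t := by
  intro h
  obtain ⟨N, hN⟩ := eventually_atTop.1 h
  have h1 : IntegrableOn (fun _ : ℝ => ε) (Ioi (max N 0)) := by
    refine Integrable.mono' (hf.mono_set (Ioi_subset_Ioi (le_max_right _ _)))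
      aestronglyMeasurable_const ?_
    filter_upwards [ae_restrict_mem measurableSet_Ioi] with t ht
    rw [Real.norm_of_nonneg hε.le]
    exact hN t ((le_max_left _ _).trans (le_of_lt ht))
  rw [integrableOn_const_iff] at h1
  simp [hε.ne'] at h1

lemma AdmissibleHL.integrableOn_potential_s5 {u u' : ℝ → ℂ} (hu : AdmissibleHL u u') (ξ : ℝ) :
    IntegrableOn (fun t => (t - ξ) ^ 2 * ‖u t‖ ^ 2) (Ioi 0) := by
  have hm : AEStronglyMeasurable (fun t => (t - ξ) ^ 2 * ‖u t‖ ^ 2) (volume.restrict (Ioi 0)) := by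
    refine ContinuousOn.aestronglyMeasurable ?_ measurableSet_Ioi
    exact (by fun_prop : Continuous fun t : ℝ => (t - ξ) ^ 2).continuousOn.mul
      ((hu.cont.mono Ioi_subset_Ici_self).norm.pow 2)
  refine Integrable.mono' ((hu.memL2t.const_mul 2).add (hu.memL2.const_mul (2 * ξ ^ 2))) hm
    (Eventually.of_forall fun t => ?_)
  rw [Real.norm_of_nonneg (by positivity)]
  simp only [Pi.add_apply]
  nlinarith [mul_nonneg (sq_nonneg (t + ξ)) (sq_nonneg ‖u t‖)]

/-- The ground state representation: the form dominates the level `1 - 2p` as soon as the Robin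
parameter is at least the logarithmic derivative of the decaying solution at the boundary. -/
lemma AdmissibleHL.mul_integral_le_qform {u u' : ℝ → ℂ} (hu : AdmissibleHL u u') {p γ ξ : ℝ}
    (hp : 0 ≤ p) (hγ : weberLogDeriv p (-ξ) ≤ γ) :
    (1 - 2 * p) * ∫ t in Ioi (0:ℝ), ‖u t‖ ^ 2 ≤ qform γ ξ u u' := by
  set h : ℝ → ℝ := fun t => weberLogDeriv p (t - ξ) with hdef
  set h' : ℝ → ℝ := fun t => (t - ξ) ^ 2 - (1 - 2 * p) - weberLogDeriv p (t - ξ) ^ 2 with hdef'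
  have hh (t : ℝ) : HasDerivAt h (h' t) t :=
    (hasDerivAt_weberLogDeriv hp (t - ξ)).comp_sub_const t ξ
  have hh' : Continuous h' := by
    have := (continuous_weberLogDeriv hp).comp (by fun_prop : Continuous fun t : ℝ => t - ξ)
    exact (by fun_prop : Continuous fun t : ℝ => (t - ξ) ^ 2 - (1 - 2 * p)).sub (this.pow 2)
  set g : ℝ → ℝ := fun t => ‖u' t‖ ^ 2 + (h' t + h t ^ 2) * ‖u t‖ ^ 2 with hg
  have hgeq : g = fun t => (‖u' t‖ ^ 2 + (t - ξ) ^ 2 * ‖u t‖ ^ 2) - (1 - 2 * p) * ‖u t‖ ^ 2 := by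
    funext t
    simp only [hg, hdef, hdef']
    ring
  have j1 : IntegrableOn (fun t => ‖u' t‖ ^ 2 + (t - ξ) ^ 2 * ‖u t‖ ^ 2) (Ioi 0) :=
    hu.memL2'.add (hu.integrableOn_potential_s5 ξ)
  have j2 : IntegrableOn (fun t => (1 - 2 * p) * ‖u t‖ ^ 2) (Ioi 0) := hu.memL2.const_mul _
  have hgint : IntegrableOn g (Ioi 0) := by
    rw [hgeq]
    exact j1.sub j2
  have hval : ∫ t in Ioi (0:ℝ), g t = (∫ t in Ioi (0:ℝ), (‖u' t‖ ^ 2 + (t - ξ) ^ 2 * ‖u t‖ ^ 2)) -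
      (1 - 2 * p) * ∫ t in Ioi (0:ℝ), ‖u t‖ ^ 2 := by
    rw [hgeq, integral_sub j1 j2, integral_const_mul]
  have hlim := intervalIntegral_tendsto_integral_Ioi 0 hgint tendsto_id
  have hmain : -(‖u 0‖ ^ 2 * h 0) ≤ ∫ t in Ioi (0:ℝ), g t := by
    by_contra! hlt
    obtain ⟨ε, hε, hε2⟩ : ∃ ε > 0, (∫ t in Ioi (0:ℝ), g t) < -(‖u 0‖ ^ 2 * h 0) - ε :=
      ⟨(-(‖u 0‖ ^ 2 * h 0) - ∫ t in Ioi (0:ℝ), g t) / 2, by linarith, by linarith⟩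
    refine not_eventually_const_le_of_integrableOn_Ioi hu.memL2t hε ?_
    filter_upwards [hlim.eventually_lt_const hε2, eventually_ge_atTop 0,
      eventually_ge_atTop (ξ + 1), eventually_ge_atTop (2 * (|ξ| + p) + 2)] with T h1 h2 h3 h4
    have h5 := hu.intervalIntegral_ge hh hh' h2
    have h6 : -h T ≤ T - ξ + p := neg_weberLogDeriv_le hp (by linarith)
    have h7 : T - ξ + p ≤ T ^ 2 := by nlinarith [neg_abs_le ξ, abs_nonneg ξ]
    have h8 : -(‖u T‖ ^ 2 * h T) ≤ T ^ 2 * ‖u T‖ ^ 2 := by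
      nlinarith [mul_le_mul_of_nonneg_right (h6.trans h7) (sq_nonneg ‖u T‖)]
    simp only [id] at h1
    linarith
  have hh0 : h 0 ≤ γ := by simpa [hdef] using hγ
  have := mul_le_mul_of_nonneg_right hh0 (sq_nonneg ‖u 0‖)
  unfold qform
  rw [hval] at hmain
  linarith

lemma AdmissibleHL.integral_sq_pos {u u' : ℝ → ℂ} (hu : AdmissibleHL u u')
    (hne : ∃ t ∈ Ici (0:ℝ), u t ≠ 0) : 0 < ∫ t in Ioi (0:ℝ), ‖u t‖ ^ 2 := by
  obtain ⟨t, ht, hut⟩ := hne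
  rw [setIntegral_pos_iff_support_of_nonneg_ae (Eventually.of_forall fun _ => sq_nonneg _) hu.memL2]
  have hev : ∀ᶠ s in 𝓝[>] t, u s ≠ 0 :=
    ((hu.cont t ht).mono (Ioi_subset_Ici ht)).eventually_ne hut
  obtain ⟨b, hb, hsub⟩ := mem_nhdsGT_iff_exists_Ioo_subset.1 hev
  have hb' : t < b := hb
  refine lt_of_lt_of_le ?_ (measure_mono (s := Ioo t b) ?_)
  · simp [hb']
  · intro s hs
    have : u s ≠ 0 := hsub hs
    exact ⟨by simpa using this, lt_of_le_of_lt ht hs.1⟩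

lemma integrable_one_add_sq_mul_exp (ξ : ℝ) :
    Integrable fun t : ℝ => (1 + (t - ξ) ^ 2) * Real.exp (-(t - ξ) ^ 2) := by
  have h1 : Integrable fun x : ℝ => Real.exp (-1 * x ^ 2) := integrable_exp_neg_mul_sq one_pos
  have h2 : Integrable fun x : ℝ => x ^ (2:ℝ) * Real.exp (-1 * x ^ 2) :=
    integrable_rpow_mul_exp_neg_mul_sq one_pos (by norm_num)
  refine ((h1.add h2).comp_sub_right ξ).congr (Eventually.of_forall fun t => ?_)
  simp only [Pi.add_apply, Real.rpow_two, neg_one_mul]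
  ring

/-- Gaussian bound for the decaying solution and its derivative on a half-line. -/
lemma exists_weberSol_sq_le {p : ℝ} (hp : 0 ≤ p) (ξ : ℝ) :
    ∃ C : ℝ, 0 ≤ C ∧ ∀ x, -ξ ≤ x →
      weberSol p x ^ 2 ≤ C * Real.exp (-x ^ 2) ∧
      (weberSol p x * weberLogDeriv p x) ^ 2 ≤ C * ((1 + x ^ 2) * Real.exp (-x ^ 2)) := by
  set K := weberFactor p (-ξ)
  set L := weberMoment p (-ξ)
  refine ⟨2 * K ^ 2 + 2 * (p * L) ^ 2, by positivity, fun x hx => ?_⟩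
  have hB := weberFactor_pos hp x
  have hA := weberMoment_pos hp x
  have h1 : weberFactor p x ^ 2 ≤ K ^ 2 := by
    have : weberFactor p x ≤ K := antitone_weberFactor hp hx
    gcongr
  have h2 : (p * weberMoment p x) ^ 2 ≤ (p * L) ^ 2 := by
    have : weberMoment p x ≤ L := antitone_weberMoment hp hx
    gcongr
  constructor
  · rw [weberSol_sq]
    gcongr
    nlinarith [sq_nonneg K, sq_nonneg (p * L)]
  · have e : (weberSol p x * weberLogDeriv p x) ^ 2 =
        (x * weberFactor p x + p * weberMoment p x) ^ 2 * Real.exp (-x ^ 2) := by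
      rw [mul_pow, weberSol_sq]
      unfold weberLogDeriv
      field_simp
      ring
    rw [e, ← mul_assoc]
    gcongr
    nlinarith [sq_nonneg (x * weberFactor p x - p * weberMoment p x),
      mul_le_mul_of_nonneg_left h1 (sq_nonneg x), mul_nonneg (sq_nonneg x) (sq_nonneg (p * L)),
      sq_nonneg K]

lemma integrableOn_of_abs_le_gaussian {f : ℝ → ℝ} (hf : Continuous f) {ξ C : ℝ}
    (h : ∀ t, 0 < t → |f t| ≤ C * ((1 + (t - ξ) ^ 2) * Real.exp (-(t - ξ) ^ 2))) :
    IntegrableOn f (Ioi 0) := by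
  refine Integrable.mono' ((integrable_one_add_sq_mul_exp ξ).integrableOn.const_mul C)
    hf.aestronglyMeasurable ?_
  filter_upwards [ae_restrict_mem measurableSet_Ioi] with t ht using h t ht

lemma integrableOn_weberSol_sq (hp : 0 ≤ p) (ξ : ℝ) :
    IntegrableOn (fun t => weberSol p (t - ξ) ^ 2) (Ioi 0) := by
  obtain ⟨C, hC, hb⟩ := exists_weberSol_sq_le hp ξ
  have hc := continuous_weberSol hp
  refine integrableOn_of_abs_le_gaussian (by fun_prop) (ξ := ξ) (C := C) fun t ht => ?_
  rw [abs_of_nonneg (by positivity)]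
  refine (hb (t - ξ) (by linarith)).1.trans ?_
  gcongr
  exact le_mul_of_one_le_left (Real.exp_pos _).le (by nlinarith [sq_nonneg (t - ξ)])

lemma integrableOn_sq_mul_weberSol_sq (hp : 0 ≤ p) (ξ : ℝ) :
    IntegrableOn (fun t => (t - ξ) ^ 2 * weberSol p (t - ξ) ^ 2) (Ioi 0) := by
  obtain ⟨C, hC, hb⟩ := exists_weberSol_sq_le hp ξ
  have hc := continuous_weberSol hp
  refine integrableOn_of_abs_le_gaussian (by fun_prop) (ξ := ξ) (C := C) fun t ht => ?_
  rw [abs_of_nonneg (by positivity)]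
  calc _ ≤ (t - ξ) ^ 2 * (C * Real.exp (-(t - ξ) ^ 2)) := by
        gcongr
        exact (hb (t - ξ) (by linarith)).1
    _ ≤ _ := by nlinarith [mul_nonneg hC (Real.exp_pos (-(t - ξ) ^ 2)).le]

lemma integrableOn_deriv_weberSol_sq (hp : 0 ≤ p) (ξ : ℝ) :
    IntegrableOn (fun t => (weberSol p (t - ξ) * weberLogDeriv p (t - ξ)) ^ 2) (Ioi 0) := by
  obtain ⟨C, hC, hb⟩ := exists_weberSol_sq_le hp ξ
  have hc := continuous_weberSol hp
  have hc' := continuous_weberLogDeriv hp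
  refine integrableOn_of_abs_le_gaussian (by fun_prop) (ξ := ξ) (C := C) fun t ht => ?_
  rw [abs_of_nonneg (by positivity)]
  exact (hb (t - ξ) (by linarith)).2

lemma admissibleHL_weberSol (hp : 0 ≤ p) (ξ : ℝ) :
    AdmissibleHL (fun t => (weberSol p (t - ξ) : ℂ))
      (fun t => ((weberSol p (t - ξ) * weberLogDeriv p (t - ξ) : ℝ) : ℂ)) := by
  have hc := continuous_weberSol hp
  have hc' := continuous_weberLogDeriv hp
  have hcont : Continuous fun t => ((weberSol p (t - ξ) * weberLogDeriv p (t - ξ) : ℝ) : ℂ) := by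
    fun_prop
  have hd (t : ℝ) : HasDerivAt (fun t => (weberSol p (t - ξ) : ℂ))
      ((weberSol p (t - ξ) * weberLogDeriv p (t - ξ) : ℝ) : ℂ) t :=
    ((hasDerivAt_weberSol hp (t - ξ)).comp_sub_const t ξ).ofReal_comp
  refine ⟨by fun_prop, fun t _ => hcont.intervalIntegrable 0 t, fun t _ => ?_, ?_, ?_, ?_⟩
  · rw [intervalIntegral.integral_eq_sub_of_hasDerivAt (fun t _ => hd t)
      (hcont.intervalIntegrable 0 t)]
    ring
  · simpa only [Complex.norm_real, Real.norm_eq_abs, sq_abs] using integrableOn_weberSol_sq hp ξ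
  · simpa only [Complex.norm_real, Real.norm_eq_abs, sq_abs] using
      integrableOn_deriv_weberSol_sq hp ξ
  · simp only [Complex.norm_real, Real.norm_eq_abs, sq_abs]
    refine Integrable.mono' (((integrableOn_sq_mul_weberSol_sq hp ξ).const_mul 2).add
      ((integrableOn_weberSol_sq hp ξ).const_mul (2 * ξ ^ 2)))
      (by fun_prop : Continuous fun t => t ^ 2 * weberSol p (t - ξ) ^ 2).aestronglyMeasurable
      (Eventually.of_forall fun t => ?_)
    rw [Real.norm_of_nonneg (by positivity)]
    simp only [Pi.add_apply]
    nlinarith [mul_nonneg (sq_nonneg (t - 2 * ξ)) (sq_nonneg (weberSol p (t - ξ)))]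

lemma qform_weberSol (hp : 0 ≤ p) (ξ : ℝ) :
    qform (weberLogDeriv p (-ξ)) ξ (fun t => (weberSol p (t - ξ) : ℂ))
      (fun t => ((weberSol p (t - ξ) * weberLogDeriv p (t - ξ) : ℝ) : ℂ)) =
      (1 - 2 * p) * ∫ t in Ioi (0:ℝ), ‖(weberSol p (t - ξ) : ℂ)‖ ^ 2 := by
  have j0 := integrableOn_weberSol_sq hp ξ
  have j1 := integrableOn_sq_mul_weberSol_sq hp ξ
  have j2 := integrableOn_deriv_weberSol_sq hp ξ
  have hc := continuous_weberSol hp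
  have hc' := continuous_weberLogDeriv hp
  have j3 : IntegrableOn (fun t => (weberSol p (t - ξ) * weberLogDeriv p (t - ξ)) ^ 2 +
      (t - ξ) ^ 2 * weberSol p (t - ξ) ^ 2) (Ioi 0) := j2.add j1
  have j4 : IntegrableOn (fun t => (1 - 2 * p) * weberSol p (t - ξ) ^ 2) (Ioi 0) :=
    j0.const_mul _
  set f : ℝ → ℝ := fun t => weberSol p (t - ξ) ^ 2 * weberLogDeriv p (t - ξ) with hf
  have hd (t : ℝ) : HasDerivAt f ((weberSol p (t - ξ) * weberLogDeriv p (t - ξ)) ^ 2 +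
      (t - ξ) ^ 2 * weberSol p (t - ξ) ^ 2 - (1 - 2 * p) * weberSol p (t - ξ) ^ 2) t := by
    refine ((((hasDerivAt_weberSol hp (t - ξ)).comp_sub_const t ξ).fun_pow 2).fun_mul
      ((hasDerivAt_weberLogDeriv hp (t - ξ)).comp_sub_const t ξ)).congr_deriv ?_
    push_cast
    ring
  have hfint : IntegrableOn f (Ioi 0) := by
    refine Integrable.mono' (j0.add j2)
      (by fun_prop : Continuous f).aestronglyMeasurable (Eventually.of_forall fun t => ?_)
    simp only [hf, Pi.add_apply, Real.norm_eq_abs, mul_pow]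
    rw [abs_mul, abs_of_nonneg (sq_nonneg _), ← mul_one_add]
    gcongr
    nlinarith [sq_abs (weberLogDeriv p (t - ξ)), sq_nonneg (|weberLogDeriv p (t - ξ)| - 1)]
  have hlim := tendsto_zero_of_hasDerivAt_of_integrableOn_Ioi (fun t _ => hd t) (j3.sub j4) hfint
  have key := integral_Ioi_of_hasDerivAt_of_tendsto' (a := 0) (fun t _ => hd t) (j3.sub j4) hlim
  rw [integral_sub j3 j4, integral_const_mul] at key
  simp only [hf, zero_sub] at key
  unfold qform
  simp only [Complex.norm_real, Real.norm_eq_abs, sq_abs, zero_sub]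
  linarith

lemma weberSol_ofReal_ne_zero (hp : 0 ≤ p) (ξ : ℝ) :
    ∃ t ∈ Ici (0:ℝ), (weberSol p (t - ξ) : ℂ) ≠ 0 :=
  ⟨0, self_mem_Ici, by exact_mod_cast (weberSol_pos hp _).ne'⟩

lemma AdmissibleHL.le_rayleigh {u u' : ℝ → ℂ} (hu : AdmissibleHL u u')
    (hne : ∃ t ∈ Ici (0:ℝ), u t ≠ 0) {γ ξ : ℝ} (hp : 0 ≤ p) (hγ : weberLogDeriv p (-ξ) ≤ γ) :
    1 - 2 * p ≤ qform γ ξ u u' / ∫ t in Ioi (0:ℝ), ‖u t‖ ^ 2 :=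
  (le_div_iff₀ (hu.integral_sq_pos hne)).2 (hu.mul_integral_le_qform hp hγ)

lemma le_mu1 (hp : 0 ≤ p) {γ ξ : ℝ} (hγ : weberLogDeriv p (-ξ) ≤ γ) : 1 - 2 * p ≤ mu1 γ ξ := by
  refine le_csInf ⟨_, _, _, admissibleHL_weberSol hp ξ, weberSol_ofReal_ne_zero hp ξ, rfl⟩ ?_
  rintro r ⟨u, u', hu, hne, rfl⟩
  exact hu.le_rayleigh hne hp hγ

lemma mu1_weberLogDeriv (hp : 0 ≤ p) (ξ : ℝ) : mu1 (weberLogDeriv p (-ξ)) ξ = 1 - 2 * p := by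
  refine le_antisymm (csInf_le ⟨1 - 2 * p, ?_⟩ ⟨_, _, admissibleHL_weberSol hp ξ,
    weberSol_ofReal_ne_zero hp ξ, ?_⟩) (le_mu1 hp le_rfl)
  · rintro r ⟨u, u', hu, hne, rfl⟩
    exact hu.le_rayleigh hne hp le_rfl
  · rw [qform_weberSol hp, mul_div_cancel_right₀]
    exact ((admissibleHL_weberSol hp ξ).integral_sq_pos (weberSol_ofReal_ne_zero hp ξ)).ne'

lemma lt_mu1 (hp : 0 < p) {γ ξ : ℝ} (hγ : weberLogDeriv p (-ξ) < γ) : 1 - 2 * p < mu1 γ ξ := by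
  have hcont : ContinuousAt (fun q => weberLogDeriv q (-ξ)) p := by
    refine (continuousOn_weberLogDeriv.comp (f := fun q : ℝ => (q, -ξ)) (s := Ici 0)
      (by fun_prop) fun q hq => hq).continuousAt (Ici_mem_nhds hp)
  have hev : ∀ᶠ q in 𝓝[<] p, weberLogDeriv q (-ξ) < γ ∧ 0 < q :=
    nhdsWithin_le_nhds ((hcont.eventually_lt_const hγ).and (lt_mem_nhds hp))
  obtain ⟨q, ⟨hq, hq0⟩, hqp⟩ := (hev.and self_mem_nhdsWithin).exists
  have hqp' : q < p := hqp
  linarith [le_mu1 hq0.le hq.le]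

end Weber

/-- For every `γ ∈ ℝ` there exists a unique `ξ*` with `μ⁽¹⁾(γ,ξ*) = Θ(γ)`;
moreover this minimizer is strictly positive and satisfies `ξ*² = Θ(γ) + γ²`. -/
theorem exists_unique_minimizer (γ : ℝ) :
    (∃! ξs : ℝ, mu1 γ ξs = Theta γ) ∧
      ∀ ξs : ℝ, mu1 γ ξs = Theta γ → 0 < ξs ∧ ξs ^ 2 = Theta γ + γ ^ 2 := by
  obtain ⟨p, x₀, hp, hx₀, hγ, hsq⟩ := exists_critical_weberLogDeriv γ
  have hmin : mu1 γ (-x₀) = 1 - 2 * p := by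
    have := mu1_weberLogDeriv hp.le (-x₀)
    rwa [neg_neg, hγ] at this
  have hstrict (ξ : ℝ) (hξ : ξ ≠ -x₀) : 1 - 2 * p < mu1 γ ξ := by
    refine lt_mu1 hp ?_
    rw [← hγ]
    exact weberLogDeriv_lt_of_ne hp.le hx₀ (by rw [hγ]; linarith)
      fun h => hξ (by rw [← h, neg_neg])
  have hle (ξ : ℝ) : 1 - 2 * p ≤ mu1 γ ξ := by
    rcases eq_or_ne ξ (-x₀) with rfl | h
    · exact hmin.ge
    · exact (hstrict ξ h).le
  have hTheta : Theta γ = 1 - 2 * p :=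
    le_antisymm (hmin ▸ ciInf_le ⟨_, by rintro _ ⟨ξ, rfl⟩; exact hle ξ⟩ (-x₀)) (le_ciInf hle)
  have huniq (ξ : ℝ) (h : mu1 γ ξ = Theta γ) : ξ = -x₀ := by
    by_contra hne
    exact (hstrict ξ hne).ne' (h.trans hTheta)
  refine ⟨⟨-x₀, hmin.trans hTheta.symm, huniq⟩, fun ξ h => ?_⟩
  rw [huniq ξ h, hTheta, neg_sq]
  exact ⟨neg_pos.2 hx₀, hsq⟩
end

section
/- Let γ ∈ ℝ, let ξ* ∈ ℝ satisfy ξ*² = Θ(γ) + γ², and let φ be a twice continuously differentiable function φ : [0,∞) → ℝ with φ > 0, ∫₀^∞ φ(t)² dt = 1, with φ, φ', and t²·φ(t) in L²((0,∞)), satisfying −φ''(t) + (t−ξ*)²φ(t) = Θ(γ)·φ(t) for all t ≥ 0 and φ'(0) = γ·φ(0). Then ∫₀^∞ (t−ξ*)·φ(t)² dt = 0. -/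
open MeasureTheory Set Filter

/-- A continuous weight of growth at most `C * (1 + t ^ 4)` times the squared ground state is
integrable on the half-line. -/
theorem IsGroundState.integrableOn_mul_sq {γ ξ μ : ℝ} {φ φ' φ'' : ℝ → ℝ}
    (h : IsGroundState γ ξ μ φ φ' φ'') {p : ℝ → ℝ} (hp : Continuous p) (C : ℝ)
    (hC : ∀ t, |p t| ≤ C * (1 + t ^ 4)) :
    IntegrableOn (fun t => p t * (φ t) ^ 2) (Ioi 0) := by
  have hcont : ContinuousOn φ (Ioi 0) := fun t ht =>
    ((h.deriv1 t (Ioi_subset_Ici_self ht)).continuousWithinAt).mono Ioi_subset_Ici_self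
  refine Integrable.mono' ((h.memL2.add h.memL2t).const_mul C)
    ((hp.continuousOn.mul (hcont.pow 2)).aestronglyMeasurable measurableSet_Ioi)
    (ae_of_all _ fun t => ?_)
  have hmul := mul_le_mul_of_nonneg_right (hC t) (sq_nonneg (φ t))
  simp only [Pi.add_apply, Real.norm_eq_abs, abs_mul, abs_of_nonneg (sq_nonneg (φ t))]
  linarith

/-- The derivative of `φ'² - ((t-ξ)² - μ)φ²` along a solution of the eigenvalue equation. -/
theorem IsGroundState.hasDerivWithinAt_virial {γ ξ μ : ℝ} {φ φ' φ'' : ℝ → ℝ}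
    (h : IsGroundState γ ξ μ φ φ' φ'') {t : ℝ} (ht : t ∈ Ici (0:ℝ)) :
    HasDerivWithinAt (fun s => (φ' s) ^ 2 - ((s - ξ) ^ 2 - μ) * (φ s) ^ 2)
      (-2 * ((t - ξ) * (φ t) ^ 2)) (Ici 0) t := by
  have hid : HasDerivWithinAt (fun s : ℝ => (s - ξ) ^ 2 - μ) (2 * (t - ξ)) (Ici 0) t := by
    simpa using ((((hasDerivAt_id t).sub_const ξ).pow 2).sub_const μ).hasDerivWithinAt
  refine (((h.deriv2 t ht).pow 2).sub (hid.mul ((h.deriv1 t ht).pow 2))).congr_deriv ?_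
  have heq : φ'' t = ((t - ξ) ^ 2 - μ) * φ t := by linarith [h.eqn t ht]
  simp only [heq, Pi.pow_apply]
  push_cast
  ring

/-- First moment identity for the ground state at the minimizing frequency. -/
theorem first_moment (γ ξs : ℝ) (hξ : ξs ^ 2 = Theta γ + γ ^ 2)
    (φ φ' φ'' : ℝ → ℝ) (h : IsGroundState γ ξs (Theta γ) φ φ' φ'') :
    (∫ t in Ioi (0:ℝ), (t - ξs) * (φ t) ^ 2) = 0 := by
  have hmoment : IntegrableOn (fun t => (t - ξs) * (φ t) ^ 2) (Ioi 0) := by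
    refine h.integrableOn_mul_sq (p := fun t => t - ξs) (by fun_prop) (1 + |ξs|) fun t => ?_
    have ht : |t| ≤ 1 + t ^ 4 := by
      rw [abs_le]
      constructor <;> nlinarith [sq_nonneg (t ^ 2 - 1), sq_nonneg (t + 1), sq_nonneg (t - 1)]
    nlinarith [abs_sub t ξs, mul_nonneg (abs_nonneg ξs) (by positivity : 0 ≤ t ^ 4)]
  have hpotential : IntegrableOn (fun t => ((t - ξs) ^ 2 - Theta γ) * (φ t) ^ 2) (Ioi 0) := by
    refine h.integrableOn_mul_sq (p := fun t => (t - ξs) ^ 2 - Theta γ) (by fun_prop)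
      (1 + 2 * ξs ^ 2 + |Theta γ|) fun t => ?_
    have hsq : (t - ξs) ^ 2 ≤ 1 + t ^ 4 + 2 * ξs ^ 2 := by
      nlinarith [sq_nonneg (t ^ 2 - 1), sq_nonneg (t + ξs)]
    have habs : |(t - ξs) ^ 2 - Theta γ| ≤ (t - ξs) ^ 2 + |Theta γ| := by
      rw [abs_le]
      constructor <;> nlinarith [sq_nonneg (t - ξs), le_abs_self (Theta γ), neg_abs_le (Theta γ)]
    have hξt : 0 ≤ ξs ^ 2 * t ^ 4 := by positivity
    have hΘt : 0 ≤ |Theta γ| * t ^ 4 := by positivity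
    linarith
  have hderiv : ∀ t ∈ Ioi (0:ℝ),
      HasDerivAt (fun s => (φ' s) ^ 2 - ((s - ξs) ^ 2 - Theta γ) * (φ s) ^ 2)
        (-2 * ((t - ξs) * (φ t) ^ 2)) t := fun t ht =>
    (h.hasDerivWithinAt_virial (Ioi_subset_Ici_self ht)).hasDerivAt (Ici_mem_nhds ht)
  have hlim := tendsto_zero_of_hasDerivAt_of_integrableOn_Ioi hderiv (hmoment.const_mul (-2))
    (h.memL2'.sub hpotential)
  have hint := integral_Ioi_of_hasDerivAt_of_tendsto
    (h.hasDerivWithinAt_virial self_mem_Ici).continuousWithinAt hderiv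
    (hmoment.const_mul (-2)) hlim
  rw [integral_const_mul, h.bc] at hint
  have hzero : (γ * φ 0) ^ 2 - ((0 - ξs) ^ 2 - Theta γ) * φ 0 ^ 2 = 0 := by
    linear_combination (-φ 0 ^ 2) * hξ
  linarith
end

section
/- Let γ ∈ ℝ, let ξ* ∈ ℝ satisfy ξ*² = Θ(γ) + γ², and let φ be a twice continuously differentiable function φ : [0,∞) → ℝ with φ > 0, ∫₀^∞ φ(t)² dt = 1, with φ, φ', and t²·φ(t) in L²((0,∞)), satisfying −φ''(t) + (t−ξ*)²φ(t) = Θ(γ)·φ(t) for all t ≥ 0 and φ'(0) = γ·φ(0). Then ∫₀^∞ (t−ξ*)²·φ(t)² dt = Θ(γ)/2 − (γ/4)·|φ(0)|². -/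
open MeasureTheory Set Filter

/-- A function with a limit at infinity that is bounded by `t` times an integrable function
tends to zero, since `1 / t` is not integrable at infinity. -/
theorem limit_eq_zero_of_abs_le_mul_integrable {F g : ℝ → ℝ} {L : ℝ}
    (hF : Tendsto F atTop (nhds L)) (hg : IntegrableOn g (Ioi 0))
    (hle : ∀ t, 1 ≤ t → |F t| ≤ t * g t) : L = 0 := by
  by_contra hL
  have hLpos : 0 < |L| := abs_pos.mpr hL
  obtain ⟨T, hT⟩ := eventually_atTop.mp
    (hF.abs.eventually (lt_mem_nhds (show |L| / 2 < |L| by linarith)))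
  refine not_integrableOn_Ioi_inv (a := max T 1) ?_
  have hsub : Ioi (max T 1) ⊆ Ioi (0 : ℝ) :=
    Ioi_subset_Ioi (zero_le_one.trans (le_max_right T 1))
  refine Integrable.mono' ((hg.mono_set hsub).const_mul (2 / |L|))
    measurable_inv.aestronglyMeasurable ?_
  filter_upwards [ae_restrict_mem measurableSet_Ioi] with t ht
  have htT : T ≤ t := (le_max_left T 1).trans (le_of_lt ht)
  have ht1 : 1 ≤ t := (le_max_right T 1).trans (le_of_lt ht)
  have htpos : 0 < t := by linarith
  have h1 : |L| / 2 < t * g t := (hT t htT).trans_le (hle t ht1)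
  rw [Real.norm_of_nonneg (inv_nonneg.mpr htpos.le), inv_le_iff_one_le_mul₀ htpos,
    div_mul_eq_mul_div, div_mul_eq_mul_div, le_div_iff₀ hLpos]
  linarith

namespace IsGroundState

variable {γ ξ μ : ℝ} {φ φ' φ'' : ℝ → ℝ}

/-- The primitive of `2 μ φ² - 4 (t - ξ)² φ²` given by the virial identity. -/
def virial (ξ μ : ℝ) (φ φ' : ℝ → ℝ) (t : ℝ) : ℝ :=
  (t - ξ) * (φ' t ^ 2 - ((t - ξ) ^ 2 - μ) * φ t ^ 2) - φ t * φ' t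

theorem hasDerivWithinAt_virial_s8 (h : IsGroundState γ ξ μ φ φ' φ'') {t : ℝ} (ht : t ∈ Ici (0 : ℝ)) :
    HasDerivWithinAt (virial ξ μ φ φ')
      (2 * μ * φ t ^ 2 - 4 * ((t - ξ) ^ 2 * φ t ^ 2)) (Ici 0) t := by
  have hφ := h.deriv1 t ht
  have hφ' := h.deriv2 t ht
  have hs : HasDerivWithinAt (fun t : ℝ => t - ξ) 1 (Ici 0) t :=
    (hasDerivWithinAt_id t _).sub_const ξ
  have heq : φ'' t = ((t - ξ) ^ 2 - μ) * φ t := by linarith [h.eqn t ht]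
  refine ((hs.mul ((hφ'.pow 2).sub (((hs.pow 2).sub_const μ).mul (hφ.pow 2)))).sub
    (hφ.mul hφ')).congr_deriv ?_
  simp [heq]
  ring

theorem integrableOn_shifted_sq (h : IsGroundState γ ξ μ φ φ' φ'') :
    IntegrableOn (fun t => (t - ξ) ^ 2 * φ t ^ 2) (Ioi 0) := by
  refine Integrable.mono' ((h.memL2.const_mul (1 + 2 * ξ ^ 2)).add h.memL2t) ?_ ?_
  · have hc : ContinuousOn φ (Ioi 0) := h.continuousOn.mono Ioi_subset_Ici_self
    exact ContinuousOn.aestronglyMeasurable (by fun_prop) measurableSet_Ioi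
  · refine Eventually.of_forall fun t => ?_
    rw [Real.norm_of_nonneg (by positivity)]
    have hs : (t - ξ) ^ 2 ≤ 1 + 2 * ξ ^ 2 + t ^ 4 := by
      nlinarith [sq_nonneg (t + ξ), sq_nonneg (t ^ 2 - 1)]
    have := mul_le_mul_of_nonneg_right hs (sq_nonneg (φ t))
    simp only [Pi.add_apply]
    linarith

theorem abs_virial_le (t : ℝ) (ht : 1 ≤ t) :
    |virial ξ μ φ φ' t| ≤ t * ((1 + |ξ|) *
      (φ' t ^ 2 + ((t - ξ) ^ 2 * φ t ^ 2 + |μ| * φ t ^ 2)) + (φ t ^ 2 + φ' t ^ 2)) := by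
  have hs : |t - ξ| ≤ t * (1 + |ξ|) := by
    have h1 := abs_sub t ξ
    rw [abs_of_nonneg (show 0 ≤ t by linarith)] at h1
    nlinarith [abs_nonneg ξ]
  have hE : |φ' t ^ 2 - ((t - ξ) ^ 2 - μ) * φ t ^ 2|
      ≤ φ' t ^ 2 + ((t - ξ) ^ 2 * φ t ^ 2 + |μ| * φ t ^ 2) := by
    have h0 := mul_nonneg (sq_nonneg (t - ξ)) (sq_nonneg (φ t))
    have h1 := mul_le_mul_of_nonneg_right (le_abs_self μ) (sq_nonneg (φ t))
    have h2 := mul_le_mul_of_nonneg_right (neg_abs_le μ) (sq_nonneg (φ t))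
    rw [abs_le]
    constructor <;> nlinarith [sq_nonneg (φ' t)]
  have hP : |φ t * φ' t| ≤ t * (φ t ^ 2 + φ' t ^ 2) := by
    have h1 : |φ t * φ' t| ≤ φ t ^ 2 + φ' t ^ 2 := by
      rw [abs_le]
      constructor <;> nlinarith [sq_nonneg (φ t + φ' t), sq_nonneg (φ t - φ' t)]
    exact h1.trans (le_mul_of_one_le_left (by positivity) ht)
  calc |virial ξ μ φ φ' t|
      ≤ |t - ξ| * |φ' t ^ 2 - ((t - ξ) ^ 2 - μ) * φ t ^ 2| + |φ t * φ' t| := by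
        rw [← abs_mul]
        exact abs_sub _ _
    _ ≤ t * (1 + |ξ|) * (φ' t ^ 2 + ((t - ξ) ^ 2 * φ t ^ 2 + |μ| * φ t ^ 2))
          + t * (φ t ^ 2 + φ' t ^ 2) :=
        add_le_add (mul_le_mul hs hE (abs_nonneg _) ((abs_nonneg _).trans hs)) hP
    _ = _ := by ring

/-- The virial identity for a ground state, with no assumption relating `ξ` and `μ`. -/
theorem virial_identity (h : IsGroundState γ ξ μ φ φ' φ'') :
    2 * μ - 4 * (∫ t in Ioi (0 : ℝ), (t - ξ) ^ 2 * φ t ^ 2) = -virial ξ μ φ φ' 0 := by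
  have hM := h.integrableOn_shifted_sq
  have hderiv : ∀ t ∈ Ioi (0 : ℝ), HasDerivAt (virial ξ μ φ φ')
      (2 * μ * φ t ^ 2 - 4 * ((t - ξ) ^ 2 * φ t ^ 2)) t := fun t ht =>
    (h.hasDerivWithinAt_virial_s8 (Ioi_subset_Ici_self ht)).hasDerivAt (Ici_mem_nhds ht)
  have hint : IntegrableOn (fun t => 2 * μ * φ t ^ 2 - 4 * ((t - ξ) ^ 2 * φ t ^ 2)) (Ioi 0) :=
    (h.memL2.const_mul (2 * μ)).sub (hM.const_mul 4)
  have hlim := tendsto_limUnder_of_hasDerivAt_of_integrableOn_Ioi hderiv hint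
  have hzero := limit_eq_zero_of_abs_le_mul_integrable hlim
    (((h.memL2'.add (hM.add (h.memL2.const_mul |μ|))).const_mul (1 + |ξ|)).add
      (h.memL2.add h.memL2')) abs_virial_le
  rw [hzero] at hlim
  have hftc := integral_Ioi_of_hasDerivAt_of_tendsto
    (h.hasDerivWithinAt_virial_s8 self_mem_Ici).continuousWithinAt hderiv hint hlim
  rw [integral_sub (h.memL2.const_mul (2 * μ)) (hM.const_mul 4), integral_const_mul,
    integral_const_mul, h.normalized] at hftc
  linarith

end IsGroundState

/-- Second moment identity for the ground state at the minimizing frequency. -/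
theorem second_moment (γ ξs : ℝ) (hξ : ξs ^ 2 = Theta γ + γ ^ 2)
    (φ φ' φ'' : ℝ → ℝ) (h : IsGroundState γ ξs (Theta γ) φ φ' φ'') :
    (∫ t in Ioi (0:ℝ), (t - ξs) ^ 2 * (φ t) ^ 2)
      = Theta γ / 2 - (γ / 4) * (φ 0) ^ 2 := by
  have hv := h.virial_identity
  have h0 : IsGroundState.virial ξs (Theta γ) φ φ' 0 = -γ * φ 0 ^ 2 := by
    simp only [IsGroundState.virial, h.bc]
    linear_combination ξs * φ 0 ^ 2 * hξ
  linarith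
end
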